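/- arXiv:2002.02396 — 2 statements merged into one kernel-verified Lean document; each statement's English description precedes it below -/
import Mathlib

section
/- Assume MA(ω₁). Then for every wide Aronszajn tree T there exist an Aronszajn tree T* and a weak embedding f : T → T*; moreover f can be chosen to preserve heights, i.e. with ht(f(x)) = ht(x) for all x ∈ T. In particular, the class of Aronszajn trees is cofinal in the class of wide Aronszajn trees ordered by weak embeddability. -/
universe u

open Cardinal Ordinal Set Classical

noncomputable def omega1 : Ordinal.{u} := (Cardinal.aleph 1).ord

/-- A tree: a partial order in which the set of strict predecessors of each element
is well-ordered by `<`. -/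
def IsTree (T : Type u) [PartialOrder T] : Prop :=
  ∀ x : T, IsWellOrder {y : T // y < x} (fun a b => (a : T) < (b : T))

/-- The height of an element of a tree: the order type of its set of strict predecessors. -/
noncomputable def treeHeight {T : Type u} [PartialOrder T] (x : T) : Ordinal.{u} :=
  if h : IsWellOrder {y : T // y < x} (fun a b => (a : T) < (b : T)) then
    @Ordinal.type _ _ h else 0

/-- The tree has height `ω₁`: every level below `ω₁` is nonempty and the level `ω₁` is empty
(equivalently, all heights are `< ω₁`). -/
def HasHeightOmega1 (T : Type u) [PartialOrder T] : Prop :=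
  (∀ α : Ordinal.{u}, α < omega1.{u} → ∃ x : T, treeHeight x = α) ∧
    ∀ x : T, treeHeight x < omega1.{u}

def NoUncountableChain (T : Type u) [PartialOrder T] : Prop :=
  ∀ C : Set T, IsChain (· < ·) C → C.Countable

def IsWideAronszajn (T : Type u) [PartialOrder T] : Prop :=
  IsTree T ∧ Cardinal.mk T = Cardinal.aleph.{u} 1 ∧ HasHeightOmega1 T ∧ NoUncountableChain T

def IsAronszajn (T : Type u) [PartialOrder T] : Prop :=
  IsTree T ∧ HasHeightOmega1 T ∧
    (∀ α : Ordinal.{u}, {x : T | treeHeight x = α}.Countable) ∧ NoUncountableChain T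

def IsWeakEmbedding {T₁ T₂ : Type u} [PartialOrder T₁] [PartialOrder T₂] (f : T₁ → T₂) : Prop :=
  ∀ x y : T₁, x < y → f x < f y

/-- Martin's axiom for ℵ₁ many dense sets. -/
def MAomega1 : Prop :=
  ∀ (P : Type u) [PartialOrder P], Nonempty P →
    (∀ A : Set P, (A.Pairwise fun p q => ¬ ∃ r, p ≤ r ∧ q ≤ r) → A.Countable) →
    ∀ 𝒟 : Set (Set P), Cardinal.mk 𝒟 ≤ Cardinal.aleph.{u} 1 →
      (∀ D ∈ 𝒟, ∀ p : P, ∃ q ∈ D, p ≤ q) →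
      ∃ G : Set P, (∀ p ∈ G, ∀ q ∈ G, ∃ r ∈ G, p ≤ r ∧ q ≤ r) ∧
        (∀ p ∈ G, ∀ q, q ≤ p → q ∈ G) ∧ ∀ D ∈ 𝒟, (G ∩ D).Nonempty

/-- A bundled partially ordered type. -/
structure PoType : Type (u + 1) where
  carrier : Type u
  str : PartialOrder carrier

attribute [instance] PoType.str

/-! ### Heights in trees -/

namespace IsTree

variable {T : Type u} [PartialOrder T]

theorem treeHeight_eq_type (hT : IsTree T) (x : T) :
    treeHeight x = @Ordinal.type {y : T // y < x} (fun a b => (a : T) < (b : T)) (hT x) := by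
  rw [treeHeight, dif_pos (hT x)]

theorem treeHeight_eq_typein (hT : IsTree T) {x y : T} (h : y < x) :
    treeHeight y = @Ordinal.typein {y : T // y < x} (fun a b => (a : T) < (b : T)) (hT x)
      ⟨y, h⟩ := by
  have := hT x
  have := hT y
  rw [hT.treeHeight_eq_type, ← Ordinal.type_subrel, Ordinal.type_eq]
  exact ⟨⟨⟨fun z => ⟨⟨z.1, z.2.trans h⟩, z.2⟩, fun z => ⟨z.1.1, z.2⟩, fun _ => rfl, fun _ => rfl⟩,
    Iff.rfl⟩⟩

theorem treeHeight_lt (hT : IsTree T) {x y : T} (h : y < x) : treeHeight y < treeHeight x := by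
  have := hT x
  rw [hT.treeHeight_eq_typein h, hT.treeHeight_eq_type x]
  exact Ordinal.typein_lt_type _ _

theorem treeHeight_le (hT : IsTree T) {x y : T} (h : y ≤ x) : treeHeight y ≤ treeHeight x := by
  rcases h.eq_or_lt with rfl | h
  · exact le_rfl
  · exact (hT.treeHeight_lt h).le

theorem eq_of_le_of_treeHeight_eq (hT : IsTree T) {x y : T} (h : y ≤ x)
    (e : treeHeight y = treeHeight x) : y = x :=
  h.eq_of_not_lt fun h' => (hT.treeHeight_lt h').ne e

theorem lt_or_eq_or_gt (hT : IsTree T) {x y z : T} (hx : x < z) (hy : y < z) :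
    x < y ∨ x = y ∨ y < x := by
  have := hT z
  have := trichotomous_of (fun a b : {y : T // y < z} => (a : T) < (b : T)) ⟨x, hx⟩ ⟨y, hy⟩
  simpa using this

theorem eq_of_le_of_le (hT : IsTree T) {x y z : T} (hx : x ≤ z) (hy : y ≤ z)
    (e : treeHeight x = treeHeight y) : x = y := by
  rcases hx.eq_or_lt with rfl | hx
  · exact (hT.eq_of_le_of_treeHeight_eq hy e.symm).symm
  rcases hy.eq_or_lt with rfl | hy
  · exact hT.eq_of_le_of_treeHeight_eq hx.le e
  rcases hT.lt_or_eq_or_gt hx hy with h | h | h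
  · exact absurd e (hT.treeHeight_lt h).ne
  · exact h
  · exact absurd e (hT.treeHeight_lt h).ne'

theorem exists_le_treeHeight_eq (hT : IsTree T) {z : T} {o : Ordinal.{u}}
    (h : o ≤ treeHeight z) : ∃ y ≤ z, treeHeight y = o := by
  rcases h.eq_or_lt with rfl | h
  · exact ⟨z, le_rfl, rfl⟩
  have := hT z
  rw [hT.treeHeight_eq_type] at h
  obtain ⟨y, hy⟩ := Ordinal.typein_surj _ h
  exact ⟨y.1, y.2.le, by rw [hT.treeHeight_eq_typein y.2, ← hy]⟩

end IsTree

theorem countable_Iic_of_lt_omega1 {o : Ordinal.{u}} (h : o < omega1) :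
    (Set.Iic o).Countable := by
  have : (Set.Iio o).Countable := by
    rw [← Cardinal.le_aleph0_iff_set_countable, Cardinal.mk_Iio_ordinal, Cardinal.lift_le_aleph0]
    rw [omega1, Cardinal.lt_ord, ← Cardinal.succ_aleph0, Order.lt_succ_iff] at h
    exact h
  rw [← Set.Iio_insert]
  exact this.insert o

/-! ### Thinning out uncountable families -/

theorem nonempty_of_not_countable {ι : Type*} {A : Set ι} (hA : ¬ A.Countable) : A.Nonempty :=
  Set.nonempty_iff_ne_empty.2 fun e => hA (e.symm ▸ Set.countable_empty)

theorem exists_uncountable_fiber {ι κ : Type*} [Countable κ] {A : Set ι} (hA : ¬ A.Countable)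
    (f : ι → κ) : ∃ k, ¬ {p ∈ A | f p = k}.Countable := by
  by_contra! h
  refine hA ((Set.countable_iUnion h).mono fun p hp => ?_)
  exact Set.mem_iUnion.2 ⟨f p, hp, rfl⟩

/-- A weak form of the `Δ`-system lemma. -/
theorem exists_root {ι X : Type*} {A : Set ι} (hA : ¬ A.Countable) (F : ι → Finset X) :
    ∃ (R : Finset X) (B : Set ι), B ⊆ A ∧ ¬ B.Countable ∧ (∀ p ∈ B, R ⊆ F p) ∧
      ∀ x ∉ R, {p ∈ B | x ∈ F p}.Countable := by
  obtain ⟨n, hn⟩ := exists_uncountable_fiber hA fun p => (F p).card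
  by_contra! h
  have key : ∀ k, ∃ R : Finset X, R.card = k ∧
      ¬ {p | (p ∈ A ∧ (F p).card = n) ∧ R ⊆ F p}.Countable := by
    intro k
    induction k with
    | zero => exact ⟨∅, rfl, by simpa using hn⟩
    | succ k ih =>
      obtain ⟨R, hR, hu⟩ := ih
      obtain ⟨x, hx, hxu⟩ := h R _ (fun p hp => hp.1.1) hu (fun p hp => hp.2)
      refine ⟨insert x R, by rw [Finset.card_insert_of_notMem hx, hR], fun hc => hxu ?_⟩
      refine hc.mono fun p hp => ?_
      exact ⟨hp.1.1, Finset.insert_subset hp.2 hp.1.2⟩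
  obtain ⟨R, hR, hu⟩ := key (n + 1)
  obtain ⟨p, ⟨-, hp⟩, hRp⟩ := nonempty_of_not_countable hu
  have := Finset.card_le_card hRp
  lia

/-! ### The forcing -/

/-- A finite set of pairs `(x, n)`, the graph of a finite function from `T` to `ℕ`, which
approximates a colouring as in `exists_colouring`. Its domain contains every truncation of its
elements to the levels it meets. -/
structure IsApprox {T : Type u} [PartialOrder T] (s : Finset (T × ℕ)) : Prop where
  closed : ∀ ⦃x m z n y⦄, (x, m) ∈ s → (z, n) ∈ s → y ≤ z → treeHeight y = treeHeight x →
    ∃ k, (y, k) ∈ s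
  coherent : ∀ ⦃x m x' m' z z' n⦄, (z, n) ∈ s → (z', n) ∈ s → treeHeight z = treeHeight z' →
    (x, m) ∈ s → (x', m') ∈ s → x ≤ z → x' ≤ z' → treeHeight x = treeHeight x' → m = m'
  ne : ∀ ⦃x m y n⦄, (x, m) ∈ s → (y, n) ∈ s → x < y → m ≠ n

/-- Finite partial colourings that can be extended to all of `T`; see
`IsExtendable.exists_isApprox`. -/
structure IsExtendable {T : Type u} [PartialOrder T] (s : Finset (T × ℕ)) : Prop where
  func : ∀ ⦃x m n⦄, (x, m) ∈ s → (x, n) ∈ s → m = n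
  transfer : ∀ ⦃x m z z' n y⦄, (x, m) ∈ s → (z, n) ∈ s → (z', n) ∈ s →
    treeHeight z = treeHeight z' → x ≤ z → y ≤ z' → treeHeight y = treeHeight x → (y, m) ∈ s
  ne : ∀ ⦃x m y n⦄, (x, m) ∈ s → (y, n) ∈ s → x < y → m ≠ n

namespace IsApprox

variable {T : Type u} [PartialOrder T] {s : Finset (T × ℕ)}

theorem isExtendable (hs : IsApprox s) : IsExtendable s where
  func _ _ _ h h' := hs.coherent h h rfl h h' le_rfl le_rfl rfl
  transfer x m z z' n y hx hz hz' e hxz hyz e' := by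
    obtain ⟨k, hk⟩ := hs.closed hx hz' hyz e'
    rwa [hs.coherent hz hz' e hx hk hxz hyz e'.symm]
  ne := hs.ne

end IsApprox

/-- `x` and `y` lie on a common level below two elements of `s` that `s` identifies. -/
def Linked {T : Type u} [PartialOrder T] (s : Finset (T × ℕ)) (x y : T) : Prop :=
  treeHeight x = treeHeight y ∧ ∃ z z' n, (z, n) ∈ s ∧ (z', n) ∈ s ∧
    treeHeight z = treeHeight z' ∧ x ≤ z ∧ y ≤ z'

section Extension

open Relation

variable {T : Type u} [PartialOrder T] {s : Finset (T × ℕ)}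

theorem treeHeight_eq_of_eqvGen {x y : T} (h : EqvGen (Linked s) x y) :
    treeHeight x = treeHeight y := by
  induction h with
  | rel _ _ h => exact h.1
  | refl => rfl
  | symm _ _ _ ih => exact ih.symm
  | trans _ _ _ _ _ ih ih' => exact ih.trans ih'

theorem eqvGen_truncate (hT : IsTree T) {x y : T} (h : EqvGen (Linked s) x y) :
    ∀ ⦃x' y'⦄, x' ≤ x → y' ≤ y → treeHeight x' = treeHeight y' →
      EqvGen (Linked s) x' y' := by
  induction h with
  | rel x y h =>
    obtain ⟨-, z, z', n, hz, hz', e, hx, hy⟩ := h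
    intro x' y' hx' hy' e'
    exact .rel _ _ ⟨e', z, z', n, hz, hz', e, hx'.trans hx, hy'.trans hy⟩
  | refl x =>
    intro x' y' hx' hy' e
    rw [hT.eq_of_le_of_le hx' hy' e]
    exact .refl _
  | symm _ _ _ ih => exact fun x' y' hx' hy' e => (ih hy' hx' e.symm).symm
  | trans x y z hxy _ ih ih' =>
    intro x' z' hx' hz' e
    have : treeHeight x' ≤ treeHeight y :=
      (hT.treeHeight_le hx').trans (treeHeight_eq_of_eqvGen hxy).le
    obtain ⟨y', hy', e'⟩ := hT.exists_le_treeHeight_eq this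
    exact (ih hx' hy' e'.symm).trans _ _ _ (ih' hy' hz' (e'.trans e))

theorem IsExtendable.mem_iff_of_eqvGen (hs : IsExtendable s) {x y : T}
    (h : EqvGen (Linked s) x y) (m : ℕ) : (x, m) ∈ s ↔ (y, m) ∈ s := by
  induction h with
  | rel x y h =>
    obtain ⟨e, z, z', n, hz, hz', e', hx, hy⟩ := h
    exact ⟨fun h => hs.transfer h hz hz' e' hx hy e.symm,
      fun h => hs.transfer h hz' hz e'.symm hy hx e⟩
  | refl => rfl
  | symm _ _ _ ih => exact ih.symm
  | trans _ _ _ _ _ ih ih' => exact ih.trans ih'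

theorem exists_finset_closed (hT : IsTree T) (v : Finset T) : ∃ D : Finset T, v ⊆ D ∧
    ∀ x ∈ D, ∀ z ∈ D, ∀ y ≤ z, treeHeight y = treeHeight x → y ∈ D := by
  have hfin : {y : T | ∃ a ∈ v, ∃ z ∈ v, y ≤ z ∧ treeHeight y = treeHeight a}.Finite := by
    have : {y : T | ∃ a ∈ v, ∃ z ∈ v, y ≤ z ∧ treeHeight y = treeHeight a} =
        ⋃ a ∈ v, ⋃ z ∈ v, {y | y ≤ z ∧ treeHeight y = treeHeight a} := by
      ext
      simp only [Set.mem_ofPred_eq, Set.mem_iUnion, exists_prop]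
    rw [this]
    refine v.finite_toSet.biUnion fun a _ => v.finite_toSet.biUnion fun z _ => ?_
    exact Set.Subsingleton.finite fun y hy y' hy' =>
      hT.eq_of_le_of_le hy.1 hy'.1 (hy.2.trans hy'.2.symm)
  refine ⟨hfin.toFinset, fun x hx => hfin.mem_toFinset.2 ⟨x, hx, x, hx, le_rfl, rfl⟩, ?_⟩
  intro x hx z hz y hyz e
  rw [hfin.mem_toFinset] at hx hz ⊢
  obtain ⟨a, ha, -, -, -, hxa⟩ := hx
  obtain ⟨-, -, z', hz', hzz', -⟩ := hz
  exact ⟨a, ha, z', hz', hyz.trans hzz', e.trans hxa⟩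

theorem IsExtendable.exists_isApprox (hT : IsTree T) (hs : IsExtendable s) (v : Finset T) :
    ∃ t : Finset (T × ℕ), IsApprox t ∧ s ⊆ t ∧ ∀ x ∈ v, ∃ n, (x, n) ∈ t := by
  obtain ⟨D, hvD, hD⟩ := exists_finset_closed hT (v ∪ s.image Prod.fst)
  have hsD : ∀ ⦃x m⦄, (x, m) ∈ s → x ∈ D := fun x m h =>
    hvD (Finset.mem_union_right _ (Finset.mem_image_of_mem Prod.fst h))
  obtain ⟨e, he⟩ := Set.countable_iff_exists_injOn.1
    ((D.finite_toSet.image (Quot.mk (Linked s))).countable)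
  obtain ⟨N, hN⟩ : ∃ N, ∀ x m, (x, m) ∈ s → m < N := by
    refine ⟨(s.image Prod.snd).sup id + 1, fun x m h => Nat.lt_succ_of_le ?_⟩
    exact Finset.le_sup (f := id) (Finset.mem_image_of_mem Prod.snd h)
  let H : T → ℕ := fun x => if h : ∃ m, (x, m) ∈ s then h.choose else N + e (Quot.mk _ x)
  have H_of_mem : ∀ ⦃x m⦄, (x, m) ∈ s → H x = m := fun x m h => by
    have h' : ∃ m, (x, m) ∈ s := ⟨m, h⟩
    simp only [H, dif_pos h']
    exact hs.func h'.choose_spec h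
  have H_of_not : ∀ ⦃x⦄, (¬ ∃ m, (x, m) ∈ s) → H x = N + e (Quot.mk _ x) := fun x h =>
    dif_neg h
  have H_congr : ∀ ⦃x y⦄, EqvGen (Linked s) x y → H x = H y := fun x y h => by
    by_cases hx : ∃ m, (x, m) ∈ s
    · obtain ⟨m, hm⟩ := hx
      rw [H_of_mem hm, H_of_mem ((hs.mem_iff_of_eqvGen h m).1 hm)]
    · have hy : ¬ ∃ m, (y, m) ∈ s := by simpa only [hs.mem_iff_of_eqvGen h] using hx
      rw [H_of_not hx, H_of_not hy, Quot.eqvGen_sound h]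
  have H_eq : ∀ ⦃x y⦄, x ∈ D → y ∈ D → H x = H y →
      (∃ m, (x, m) ∈ s ∧ (y, m) ∈ s) ∨ EqvGen (Linked s) x y := fun x y hx hy h => by
    by_cases hx' : ∃ m, (x, m) ∈ s <;> by_cases hy' : ∃ m, (y, m) ∈ s
    · obtain ⟨m, hm⟩ := hx'
      obtain ⟨n, hn⟩ := hy'
      rw [H_of_mem hm, H_of_mem hn] at h
      exact .inl ⟨m, hm, h ▸ hn⟩
    · obtain ⟨m, hm⟩ := hx'
      have := hN _ _ hm
      rw [H_of_mem hm, H_of_not hy'] at h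
      lia
    · obtain ⟨m, hm⟩ := hy'
      have := hN _ _ hm
      rw [H_of_mem hm, H_of_not hx'] at h
      lia
    · rw [H_of_not hx', H_of_not hy', Nat.add_left_cancel_iff] at h
      exact .inr (Quot.eqvGen_exact
        (he (Set.mem_image_of_mem _ hx) (Set.mem_image_of_mem _ hy) h))
  have mem_iff : ∀ {x m}, (x, m) ∈ D.image (fun x => (x, H x)) ↔ x ∈ D ∧ H x = m := by
    simp
  refine ⟨D.image fun x => (x, H x), ⟨?_, ?_, ?_⟩, ?_, ?_⟩
  · intro x m z n y hx hz hyz h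
    exact ⟨H y, mem_iff.2 ⟨hD x (mem_iff.1 hx).1 z (mem_iff.1 hz).1 y hyz h, rfl⟩⟩
  · intro x m x' m' z z' n hz hz' h hx hx' hxz hxz' h'
    rw [mem_iff] at hz hz' hx hx'
    rw [← hx.2, ← hx'.2]
    refine H_congr ?_
    rcases H_eq hz.1 hz'.1 (hz.2.trans hz'.2.symm) with ⟨k, hk, hk'⟩ | hE
    · exact .rel _ _ ⟨h', z, z', k, hk, hk', h, hxz, hxz'⟩
    · exact eqvGen_truncate hT hE hxz hxz' h'
  · intro x m y n hx hy hxy h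
    rw [mem_iff] at hx hy
    rcases H_eq hx.1 hy.1 (by rw [hx.2, hy.2, h]) with ⟨k, hk, hk'⟩ | hE
    · exact hs.ne hk hk' hxy rfl
    · exact (hT.treeHeight_lt hxy).ne (treeHeight_eq_of_eqvGen hE)
  · rintro ⟨x, m⟩ h
    exact mem_iff.2 ⟨hsD h, H_of_mem h⟩
  · intro x hx
    exact ⟨H x, mem_iff.2 ⟨hvD (Finset.mem_union_left _ hx), rfl⟩⟩

end Extension

/-- The amalgamation criterion behind the countable chain condition. Here `w` plays the role of
the set of common levels of `p` and `q`. -/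
theorem IsApprox.isExtendable_union {T : Type u} [PartialOrder T] (hT : IsTree T)
    {p q : Finset (T × ℕ)} (hp : IsApprox p) (hq : IsApprox q) {w : Set Ordinal.{u}}
    (hwp : ∀ o ∈ w, ∃ a k, (a, k) ∈ p ∧ treeHeight a = o)
    (hwq : ∀ o ∈ w, ∃ a k, (a, k) ∈ q ∧ treeHeight a = o)
    (hltp : ∀ ⦃x m⦄, (x, m) ∈ p → treeHeight x ∉ w → ∀ o ∈ w, o < treeHeight x)
    (hltq : ∀ ⦃x m⦄, (x, m) ∈ q → treeHeight x ∉ w → ∀ o ∈ w, o < treeHeight x)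
    (hlt : ∀ ⦃x m y n⦄, (x, m) ∈ p → (y, n) ∈ q → treeHeight x ∉ w → treeHeight y ∉ w →
      treeHeight x < treeHeight y)
    (hfun : ∀ ⦃x m n⦄, (x, m) ∈ p → (x, n) ∈ q → m = n)
    (htwin : ∀ ⦃y m z n⦄, (y, m) ∈ q → (z, n) ∈ q → y ≤ z → treeHeight y ∈ w →
      treeHeight z ∈ w → ∃ y' z', (y', m) ∈ p ∧ (z', n) ∈ p ∧ y' ≤ z' ∧
        treeHeight y' = treeHeight y ∧ treeHeight z' = treeHeight z)
    (hinc : ∀ ⦃x m z n⦄, (x, m) ∈ p → (z, n) ∈ q → treeHeight x ∉ w → treeHeight z ∉ w →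
      ¬ x < z) :
    IsExtendable (p ∪ q) := by
  have mem_p : ∀ ⦃x m z n⦄, (x, m) ∈ p ∪ q → (z, n) ∈ p → x ≤ z → (x, m) ∈ p := by
    intro x m z n hx hz hxz
    refine (Finset.mem_union.1 hx).elim id fun hx => ?_
    have hxw : treeHeight x ∈ w := by
      by_contra hxw
      by_cases hzw : treeHeight z ∈ w
      · exact (hltq hx hxw _ hzw).not_ge (hT.treeHeight_le hxz)
      · exact (hlt hz hx hzw hxw).not_ge (hT.treeHeight_le hxz)
    obtain ⟨a, k, ha, e⟩ := hwp _ hxw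
    obtain ⟨l, hl⟩ := hp.closed ha hz hxz e.symm
    rwa [← hfun hl hx]
  have mem_q : ∀ ⦃x m z n⦄, (x, m) ∈ p ∪ q → (z, n) ∈ q → x ≤ z → (x, m) ∈ q := by
    intro x m z n hx hz hxz
    refine (Finset.mem_union.1 hx).elim (fun hx => ?_) id
    have hxw : treeHeight x ∈ w := by
      by_contra hxw
      by_cases hzw : treeHeight z ∈ w
      · exact (hltp hx hxw _ hzw).not_ge (hT.treeHeight_le hxz)
      · rcases hxz.eq_or_lt with rfl | h
        · exact (hlt hx hz hxw hzw).false
        · exact hinc hx hz hxw hzw h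
    obtain ⟨a, k, ha, e⟩ := hwq _ hxw
    obtain ⟨l, hl⟩ := hq.closed ha hz hxz e.symm
    rwa [hfun hx hl]
  have mem_w : ∀ ⦃x m z n z' n'⦄, (x, m) ∈ p ∪ q → (z, n) ∈ p → (z', n') ∈ q →
      treeHeight z = treeHeight z' → treeHeight x ≤ treeHeight z →
      treeHeight z ∈ w ∧ treeHeight x ∈ w := by
    intro x m z n z' n' hx hz hz' e hxz
    have hzw : treeHeight z ∈ w := by
      by_contra hzw
      exact (hlt hz hz' hzw (e ▸ hzw)).ne e
    refine ⟨hzw, by_contra fun hxw => hxz.not_gt ?_⟩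
    rcases Finset.mem_union.1 hx with hx | hx
    · exact hltp hx hxw _ hzw
    · exact hltq hx hxw _ hzw
  refine ⟨?_, ?_, ?_⟩
  · intro x m n hm hn
    rcases Finset.mem_union.1 hm with hm | hm
    · exact hp.isExtendable.func hm (mem_p hn hm le_rfl)
    · exact hq.isExtendable.func hm (mem_q hn hm le_rfl)
  · intro x m z z' n y hx hz hz' e hxz hyz e'
    rw [Finset.mem_union] at hz hz' ⊢
    rcases hz with hz | hz <;> rcases hz' with hz' | hz'
    · exact .inl (hp.isExtendable.transfer (mem_p hx hz hxz) hz hz' e hxz hyz e')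
    · obtain ⟨hzw, hxw⟩ := mem_w hx hz hz' e (hT.treeHeight_le hxz)
      obtain ⟨a, l, ha, hax⟩ := hwq _ hxw
      obtain ⟨k, hk⟩ := hq.closed ha hz' hyz (e'.trans hax.symm)
      obtain ⟨y', z'', hy', hz'', hyz', ey, ez⟩ := htwin hk hz' hyz (e' ▸ hxw) (e ▸ hzw)
      rw [hp.coherent hz hz'' (e.trans ez.symm) (mem_p hx hz hxz) hy' hxz hyz'
        (e'.symm.trans ey.symm)]
      exact .inr hk
    · obtain ⟨hzw, hxw⟩ := mem_w hx hz' hz e.symm (e ▸ hT.treeHeight_le hxz)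
      obtain ⟨x', z'', hx', hz'', hxz', ex, ez⟩ := htwin (mem_q hx hz hxz) hz hxz hxw (e ▸ hzw)
      exact .inl (hp.isExtendable.transfer hx' hz'' hz' (ez.trans e) hxz' hyz (e'.trans ex.symm))
    · exact .inr (hq.isExtendable.transfer (mem_q hx hz hxz) hz hz' e hxz hyz e')
  · intro x m y n hx hy hxy
    rcases Finset.mem_union.1 hy with hy | hy
    · exact hp.ne (mem_p hx hy hxy.le) hy hxy
    · exact hq.ne (mem_q hx hy hxy.le) hy hxy

/-- In a tree with no uncountable chain, an uncountable family of bounded finite sets, in which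
every element lies in only countably many members, has members `F p`, `F q` with no element of
`F p` below an element of `F q`. -/
theorem exists_forall_not_lt {T ι : Type*} [PartialOrder T]
    (htri : ∀ ⦃x y z : T⦄, x < z → y < z → x < y ∨ x = y ∨ y < x)
    (hchain : ∀ C : Set T, IsChain (· < ·) C → C.Countable) {A : Set ι} (hA : ¬ A.Countable)
    {F : ι → Finset T} {n : ℕ} (hn : ∀ p ∈ A, (F p).card ≤ n)
    (hF : ∀ x, {p ∈ A | x ∈ F p}.Countable) :
    ∃ p ∈ A, ¬ {q ∈ A | ∀ x ∈ F p, ∀ z ∈ F q, ¬ x < z}.Countable := by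
  by_contra! h
  have hne : (Filter.cocountable ⊓ Filter.principal A).NeBot := by
    rw [Filter.inf_principal_neBot_iff]
    intro U hU
    by_contra hUA
    refine hA ((Filter.mem_cocountable.1 hU).mono fun p hp hpU => hUA ⟨p, hpU, hp⟩)
  let 𝒰 : Ultrafilter ι := Ultrafilter.of (Filter.cocountable ⊓ Filter.principal A)
  have h𝒰 : ∀ p ∈ A, ∃ e ∈ F p ×ˢ Finset.range n,
      {q | ∃ z, (F q).toList[e.2]? = some z ∧ e.1 < z} ∈ 𝒰 := by
    intro p hp
    refine (Ultrafilter.finite_biUnion_mem_iff (F p ×ˢ Finset.range n).finite_toSet).1 ?_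
    have hmem : {q ∈ A | ∀ x ∈ F p, ∀ z ∈ F q, ¬ x < z}ᶜ ∩ A ∈ 𝒰 := by
      refine Ultrafilter.of_le _ (Filter.inter_mem_inf ?_ (Filter.mem_principal_self A))
      rw [Filter.mem_cocountable, compl_compl]
      exact h p hp
    refine Filter.mem_of_superset hmem ?_
    rintro q ⟨hq, hqA⟩
    have : ∃ x ∈ F p, ∃ z ∈ F q, x < z := by
      by_contra! hcon
      exact hq ⟨hqA, hcon⟩
    obtain ⟨x, hx, z, hz, hxz⟩ := this
    obtain ⟨j, hj⟩ := List.mem_iff_getElem?.1 (Finset.mem_toList.2 hz)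
    have hjn : j < n := by
      obtain ⟨hj', -⟩ := List.getElem?_eq_some_iff.1 hj
      rw [Finset.length_toList] at hj'
      exact hj'.trans_le (hn q hqA)
    refine Set.mem_biUnion (x := (x, j)) ?_ ⟨z, hj, hxz⟩
    simp [hx, hjn]
  obtain ⟨p₀, hp₀⟩ := nonempty_of_not_countable hA
  have : Nonempty (T × ℕ) := ⟨(h𝒰 p₀ hp₀).choose⟩
  choose! e he he𝒰 using h𝒰
  obtain ⟨j, hj⟩ := exists_uncountable_fiber hA fun p => (e p).2
  have hC : ((fun p => (e p).1) '' {p ∈ A | (e p).2 = j}).Countable := by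
    refine hchain _ ?_
    rintro _ ⟨p, ⟨hp, hpj⟩, rfl⟩ _ ⟨p', ⟨hp', hpj'⟩, rfl⟩ hne
    obtain ⟨q, ⟨z, hz, hlt⟩, z', hz', hlt'⟩ :=
      Ultrafilter.nonempty_of_mem (Filter.inter_mem (he𝒰 p hp) (he𝒰 p' hp'))
    rw [hpj] at hz
    rw [hpj', hz, Option.some_inj] at hz'
    subst hz'
    rcases htri hlt hlt' with h | h | h
    · exact .inl h
    · exact absurd h hne
    · exact .inr h
  refine hj ((hC.biUnion fun x _ => hF x).mono fun p hp => ?_)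
  refine Set.mem_biUnion (Set.mem_image_of_mem _ hp) ⟨hp.1, ?_⟩
  exact (Finset.mem_product.1 (he p hp.1)).1

/-- The poset of approximations has the countable chain condition. -/
theorem countable_of_pairwise_incompatible {T : Type u} [PartialOrder T] (hT : IsTree T)
    (hht : ∀ x : T, treeHeight x < omega1.{u}) (hchain : NoUncountableChain T)
    (A : Set {s : Finset (T × ℕ) // IsApprox s})
    (hA : A.Pairwise fun p q => ¬ ∃ r, p ≤ r ∧ q ≤ r) : A.Countable := by
  by_contra hunc
  obtain ⟨n, hn⟩ := exists_uncountable_fiber hunc fun p => p.1.card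
  -- The type of an approximation records the levels and colours of its comparable pairs.
  let τ : {s : Finset (T × ℕ) // IsApprox s} → Finset ((Ordinal.{u} × ℕ) × (Ordinal.{u} × ℕ)) :=
    fun p => ((p.1 ×ˢ p.1).filter fun e => e.1.1 ≤ e.2.1).image
      fun e => ((treeHeight e.1.1, e.1.2), (treeHeight e.2.1, e.2.2))
  have mem_τ : ∀ {p a m b n}, ((a, m), (b, n)) ∈ τ p ↔
      ∃ x z, (x, m) ∈ p.1 ∧ (z, n) ∈ p.1 ∧ x ≤ z ∧ treeHeight x = a ∧ treeHeight z = b := by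
    intro p a m b n
    simp only [τ, Finset.mem_image, Finset.mem_filter, Finset.mem_product, Prod.exists,
      Prod.mk.injEq]
    constructor
    · rintro ⟨x, _, z, _, ⟨⟨hx, hz⟩, hxz⟩, ⟨rfl, rfl⟩, rfl, rfl⟩
      exact ⟨x, z, hx, hz, hxz, rfl, rfl⟩
    · rintro ⟨x, z, hx, hz, hxz, rfl, rfl⟩
      exact ⟨x, m, z, n, ⟨⟨hx, hz⟩, hxz⟩, ⟨rfl, rfl⟩, rfl, rfl⟩
  obtain ⟨R, B₁, hB₁, hunc₁, hR, hR'⟩ := exists_root hn τ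
  obtain ⟨S, B, hB, hunc, hS, hS'⟩ := exists_root hunc₁ Subtype.val
  let w : Set Ordinal.{u} := {o | ∃ m, ((o, m), (o, m)) ∈ R}
  have hw : ∀ p ∈ B, ∀ o ∈ w, ∃ a k, (a, k) ∈ p.1 ∧ treeHeight a = o := by
    rintro p hp o ⟨m, hm⟩
    obtain ⟨x, -, hx, -, -, e, -⟩ := mem_τ.1 (hR p (hB hp) hm)
    exact ⟨x, m, hx, e⟩
  have hwc : w.Countable := by
    refine (R.finite_toSet.image fun e => e.1.1).countable.mono ?_
    rintro o ⟨m, hm⟩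
    exact ⟨_, hm, rfl⟩
  have hw_lt : ∀ o ∈ w, o < omega1 := by
    intro o ho
    obtain ⟨p, hp⟩ := nonempty_of_not_countable hunc
    obtain ⟨a, -, -, rfl⟩ := hw p hp o ho
    exact hht a
  -- Outside `w`, every level and every bounded set of levels is met by few members of `B`.
  have hlevel : ∀ o ∉ w, {p ∈ B | ∃ x m, (x, m) ∈ p.1 ∧ treeHeight x = o}.Countable := by
    intro o ho
    refine (Set.countable_iUnion fun m => hR' ((o, m), (o, m)) fun h => ho ⟨m, h⟩).mono ?_
    rintro p ⟨hp, x, m, hx, e⟩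
    exact Set.mem_iUnion.2 ⟨m, hB hp, mem_τ.2 ⟨x, x, hx, hx, le_rfl, e, e⟩⟩
  have hbdd : ∀ o < omega1,
      {p ∈ B | ∃ x m, (x, m) ∈ p.1 ∧ treeHeight x ∉ w ∧ treeHeight x ≤ o}.Countable := by
    intro o ho
    refine (((countable_Iic_of_lt_omega1 ho).mono Set.sdiff_subset).biUnion
      fun b (hb : b ∈ Set.Iic o \ w) => hlevel b hb.2).mono ?_
    rintro p ⟨hp, x, m, hx, hxw, hxo⟩
    exact Set.mem_biUnion (x := treeHeight x) ⟨hxo, hxw⟩ ⟨hp, x, m, hx, rfl⟩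
  -- Discard the countably many members whose levels or whose type are not as expected.
  let C : Set {s : Finset (T × ℕ) // IsApprox s} :=
    {p ∈ B | (∀ x m, (x, m) ∈ p.1 → treeHeight x ∉ w → ∀ o ∈ w, o < treeHeight x) ∧
      ∀ a ∈ w, ∀ b ∈ w, ∀ m n, ((a, m), (b, n)) ∈ τ p → ((a, m), (b, n)) ∈ R}
  have hCB : (B \ C).Countable := by
    have h₁ : (⋃ o ∈ w, {p ∈ B | ∃ x m, (x, m) ∈ p.1 ∧ treeHeight x ∉ w ∧
        treeHeight x ≤ o}).Countable := hwc.biUnion fun o ho => hbdd o (hw_lt o ho)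
    have h₂ : (⋃ a ∈ w, ⋃ b ∈ w, ⋃ m : ℕ, ⋃ n : ℕ,
        {p ∈ B | ((a, m), (b, n)) ∈ τ p ∧ ((a, m), (b, n)) ∉ R}).Countable := by
      refine hwc.biUnion fun a _ => hwc.biUnion fun b _ => Set.countable_iUnion fun m =>
        Set.countable_iUnion fun n => ?_
      by_cases h : ((a, m), (b, n)) ∈ R
      · simp [h]
      · refine (hR' _ h).mono fun p hp => ?_
        exact ⟨hB hp.1, hp.2.1⟩
    refine (h₁.union h₂).mono ?_
    rintro p ⟨hp, hpC⟩
    by_contra! hcon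
    simp only [Set.mem_union, Set.mem_iUnion, not_or, not_exists] at hcon
    refine hpC ⟨hp, fun x m hx hxw o ho => ?_, fun a ha b hb m n h => ?_⟩
    · by_contra! hle
      exact hcon.1 o ho ⟨hp, x, m, hx, hxw, hle⟩
    · by_contra hnot
      exact hcon.2 a ha b hb m n ⟨hp, h, hnot⟩
  have hC : ¬ C.Countable := fun h =>
    hunc ((h.union hCB).mono fun p hp => (Classical.em (p ∈ C)).imp id fun h => ⟨hp, h⟩)
  let F : {s : Finset (T × ℕ) // IsApprox s} → Finset T :=
    fun p => (p.1.image Prod.fst).filter fun x => treeHeight x ∉ w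
  have mem_F : ∀ {p x}, x ∈ F p ↔ (∃ m, (x, m) ∈ p.1) ∧ treeHeight x ∉ w := by
    simp [F]
  have hFcard : ∀ p ∈ C, (F p).card ≤ n := fun p hp =>
    ((Finset.card_filter_le _ _).trans Finset.card_image_le).trans_eq (hB₁ (hB hp.1)).2
  have hFc : ∀ x, {p ∈ C | x ∈ F p}.Countable := by
    intro x
    by_cases hx : treeHeight x ∈ w
    · simp [mem_F, hx]
    · refine (hlevel _ hx).mono ?_
      rintro p ⟨hp, h⟩
      obtain ⟨⟨m, hm⟩, -⟩ := mem_F.1 h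
      exact ⟨hp.1, x, m, hm, rfl⟩
  obtain ⟨p, hp, hpq⟩ := exists_forall_not_lt (fun _ _ _ => hT.lt_or_eq_or_gt) hchain hC hFcard hFc
  -- Only countably many `q` interfere with `p` in some other way.
  have hlevels : {q ∈ B | ∃ x m, (x, m) ∈ p.1 ∧ ∃ z k, (z, k) ∈ q.1 ∧ treeHeight z ∉ w ∧
      treeHeight z ≤ treeHeight x}.Countable := by
    refine (p.1.countable_toSet.biUnion fun e _ => hbdd (treeHeight e.1) (hht e.1)).mono ?_
    rintro q ⟨hq, x, m, hx, h⟩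
    exact Set.mem_biUnion (x := (x, m)) hx ⟨hq, h⟩
  have hvalues : {q ∈ B | ∃ x m k, (x, m) ∈ p.1 ∧ (x, k) ∈ q.1 ∧ m ≠ k}.Countable := by
    have : (⋃ e ∈ p.1, ⋃ k : ℕ, {q ∈ B | (e.1, k) ∈ q.1 ∧ e.2 ≠ k}).Countable := by
      refine p.1.countable_toSet.biUnion fun e he => Set.countable_iUnion fun k => ?_
      by_cases hk : (e.1, k) ∈ S
      · have : e.2 = k := p.2.isExtendable.func he (hS p hp.1 hk)
        simp [this]
      · refine (hS' _ hk).mono fun q hq => ?_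
        exact ⟨hq.1, hq.2.1⟩
    refine this.mono ?_
    rintro q ⟨hq, x, m, k, hx, hk, hne⟩
    exact Set.mem_biUnion (x := (x, m)) hx (Set.mem_iUnion.2 ⟨k, hq, hk, hne⟩)
  obtain ⟨q, ⟨hq, hinc⟩, hgood⟩ : ∃ q, (q ∈ C ∧ ∀ x ∈ F p, ∀ z ∈ F q, ¬ x < z) ∧
      ¬ (q ∈ {p} ∪ ({q ∈ B | ∃ x m, (x, m) ∈ p.1 ∧ ∃ z k, (z, k) ∈ q.1 ∧ treeHeight z ∉ w ∧
      treeHeight z ≤ treeHeight x} ∪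
      {q ∈ B | ∃ x m k, (x, m) ∈ p.1 ∧ (x, k) ∈ q.1 ∧ m ≠ k})) := by
    by_contra! hcon
    exact hpq (((Set.countable_singleton p).union (hlevels.union hvalues)).mono hcon)
  simp only [Set.mem_union, not_or] at hgood
  obtain ⟨hqp, hgood₁, hgood₂⟩ := hgood
  have hext : IsExtendable (p.1 ∪ q.1) := by
    refine p.2.isExtendable_union hT q.2 (hw p hp.1) (hw q hq.1) hp.2.1 hq.2.1 ?_ ?_ ?_ ?_
    · intro x m y k hx hy _ hyw
      by_contra! hle
      exact hgood₁ ⟨hq.1, x, m, hx, y, k, hy, hyw, hle⟩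
    · intro x m k hm hk
      by_contra hne
      exact hgood₂ ⟨hq.1, x, m, k, hm, hk, hne⟩
    · intro y m z k hy hz hyz hyw hzw
      exact mem_τ.1 (hR p (hB hp.1)
        (hq.2.2 _ hyw _ hzw m k (mem_τ.2 ⟨y, z, hy, hz, hyz, rfl, rfl⟩)))
    · intro x m z k hx hz hxw hzw
      exact hinc x (mem_F.2 ⟨⟨m, hx⟩, hxw⟩) z (mem_F.2 ⟨⟨k, hz⟩, hzw⟩)
  obtain ⟨r, hr, hpqr, -⟩ := hext.exists_isApprox hT ∅
  exact hA (hB₁ (hB hp.1)).1 (hB₁ (hB hq.1)).1 (fun h => hqp h.symm)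
    ⟨⟨r, hr⟩, Finset.union_subset_left hpqr, Finset.union_subset_right hpqr⟩

/-- Under `MA(ω₁)` a tree with no uncountable chain has a colouring that is injective on chains
and for which the identification of equally coloured elements of a level is preserved by
truncation. -/
theorem exists_colouring (hMA : MAomega1.{u}) {T : Type u} [PartialOrder T]
    (h : IsWideAronszajn T) :
    ∃ c : T → ℕ, (∀ ⦃z z' x x' : T⦄, treeHeight z = treeHeight z' → c z = c z' → x ≤ z →
      x' ≤ z' → treeHeight x = treeHeight x' → c x = c x') ∧ ∀ ⦃x y⦄, x < y → c x ≠ c y := by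
  obtain ⟨hT, hcard, ⟨-, hht⟩, hchain⟩ := h
  have hempty : IsApprox (∅ : Finset (T × ℕ)) :=
    ⟨by simp, by simp, by simp⟩
  let 𝒟 : T → Set {s : Finset (T × ℕ) // IsApprox s} := fun x => {s | ∃ n, (x, n) ∈ s.1}
  obtain ⟨G, hdir, -, hG⟩ := hMA {s : Finset (T × ℕ) // IsApprox s} ⟨⟨∅, hempty⟩⟩
    (countable_of_pairwise_incompatible hT hht hchain) (Set.range 𝒟)
    (Cardinal.mk_range_le.trans hcard.le) (by
      rintro _ ⟨x, rfl⟩ p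
      obtain ⟨t, ht, hpt, hx⟩ := p.2.isExtendable.exists_isApprox hT {x}
      exact ⟨⟨t, ht⟩, hx x (Finset.mem_singleton_self x), hpt⟩)
  have hG' : ∀ x, ∃ n, ∃ p ∈ G, (x, n) ∈ p.1 := by
    intro x
    obtain ⟨p, hp, n, hn⟩ := hG _ ⟨x, rfl⟩
    exact ⟨n, p, hp, hn⟩
  choose c P hPG hP using hG'
  refine ⟨c, fun z z' x x' e ec hx hx' e' => ?_, fun x y hxy => ?_⟩
  · obtain ⟨r, hr, h₁, h₂⟩ := hdir _ (hPG z) _ (hPG z')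
    obtain ⟨r', hr', h₃, h₄⟩ := hdir _ (hPG x) _ (hPG x')
    obtain ⟨t, -, h₅, h₆⟩ := hdir _ hr _ hr'
    exact t.2.coherent (h₅ (h₁ (hP z))) (ec ▸ h₅ (h₂ (hP z'))) e (h₆ (h₃ (hP x)))
      (h₆ (h₄ (hP x'))) hx hx' e'
  · obtain ⟨r, hr, h₁, h₂⟩ := hdir _ (hPG x) _ (hPG y)
    exact r.2.ne (h₁ (hP x)) (h₂ (hP y)) hxy

/-! ### The quotient tree -/

section Quotient

variable {T : Type u} [PartialOrder T]

/-- The identification of elements of the same level and colour. -/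
noncomputable def levelSetoid (c : T → ℕ) : Setoid T :=
  Setoid.ker fun x => (treeHeight x, c x)

/-- The quotient of `T` by the identification of elements of the same level and colour. -/
def LevelQuotient (c : T → ℕ) : Type u :=
  Quotient (levelSetoid c)

namespace LevelQuotient

/-- The projection of `T` to its quotient. -/
noncomputable def mk (c : T → ℕ) (x : T) : LevelQuotient c :=
  Quotient.mk (levelSetoid c) x

/-- The colour of an element of the quotient. -/
noncomputable def colour {c : T → ℕ} : LevelQuotient c → ℕ :=
  Quotient.lift c fun _ _ e => (Prod.mk_inj.1 e).2

theorem mk_surjective (c : T → ℕ) : Function.Surjective (mk c) :=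
  Quotient.exists_rep

theorem mk_eq_mk {c : T → ℕ} {x y : T} :
    mk c x = mk c y ↔ treeHeight x = treeHeight y ∧ c x = c y :=
  Quotient.eq.trans Prod.mk_inj

/-- The order induced on the quotient of `T` by a truncation-compatible colouring. -/
@[reducible]
noncomputable def partialOrder (hT : IsTree T) (c : T → ℕ)
    (hc : ∀ ⦃z z' x x' : T⦄, treeHeight z = treeHeight z' → c z = c z' → x ≤ z →
      x' ≤ z' → treeHeight x = treeHeight x' → c x = c x') :
    PartialOrder (LevelQuotient c) where
  le a b := ∃ x y, mk c x = a ∧ mk c y = b ∧ x ≤ y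
  le_refl a := by
    obtain ⟨x, rfl⟩ := mk_surjective c a
    exact ⟨x, x, rfl, rfl, le_rfl⟩
  le_trans := by
    rintro _ _ _ ⟨x, y, rfl, rfl, hxy⟩ ⟨y', z, e, rfl, hyz⟩
    obtain ⟨e, e'⟩ := mk_eq_mk.1 e
    obtain ⟨x', hx', ex⟩ := hT.exists_le_treeHeight_eq (e ▸ hT.treeHeight_le hxy)
    exact ⟨x', z, mk_eq_mk.2 ⟨ex, hc e e' hx' hxy ex⟩, rfl, hx'.trans hyz⟩
  le_antisymm := by
    rintro _ _ ⟨x, y, rfl, rfl, hxy⟩ ⟨y', x', ey, ex, hyx⟩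
    have h := hT.treeHeight_le hyx
    rw [(mk_eq_mk.1 ey).1, (mk_eq_mk.1 ex).1] at h
    rw [hT.eq_of_le_of_treeHeight_eq hxy ((hT.treeHeight_le hxy).antisymm h)]

end LevelQuotient

end Quotient

/-- Under MA(ω₁), every wide Aronszajn tree weakly embeds into an Aronszajn tree,
moreover by a height-preserving weak embedding. -/
theorem wide_Aronszajn_embeds_into_Aronszajn (hMA : MAomega1.{u}) :
    ∀ (T : Type u) [PartialOrder T], IsWideAronszajn T →
      ∃ S : PoType.{u}, IsAronszajn S.carrier ∧
        ∃ f : T → S.carrier, IsWeakEmbedding f ∧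
          ∀ x : T, treeHeight (f x) = treeHeight x := by
  intro T _ h
  obtain ⟨c, hc, hne⟩ := exists_colouring hMA h
  obtain ⟨hT, -, ⟨hlevels, hht⟩, -⟩ := h
  let _ := LevelQuotient.partialOrder hT c hc
  let π : T → LevelQuotient c := LevelQuotient.mk c
  have π_surj : Function.Surjective π := LevelQuotient.mk_surjective c
  have π_lt : ∀ {x y}, x < y → π x < π y := fun {x y} hxy =>
    lt_of_le_of_ne ⟨x, y, rfl, rfl, hxy.le⟩ fun e =>
      (hT.treeHeight_lt hxy).ne (LevelQuotient.mk_eq_mk.1 e).1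
  have exists_lt : ∀ {a z}, a < π z → ∃ x < z, π x = a := by
    intro a z haz
    obtain ⟨x, y, rfl, e, hxy⟩ := haz.le
    obtain ⟨e, e'⟩ := LevelQuotient.mk_eq_mk.1 e
    obtain ⟨x', hx', ex⟩ := hT.exists_le_treeHeight_eq (e ▸ hT.treeHeight_le hxy)
    have hx : π x' = π x := LevelQuotient.mk_eq_mk.2 ⟨ex, hc e.symm e'.symm hx' hxy ex⟩
    refine ⟨x', hx'.lt_of_ne ?_, hx⟩
    rintro rfl
    exact haz.ne hx.symm
  have iso : ∀ z, Nonempty ((fun a b : {x : T // x < z} => (a : T) < (b : T)) ≃r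
      (fun a b : {s // s < π z} => (a : LevelQuotient c) < b)) := by
    intro z
    let g : {x : T // x < z} → {s // s < π z} := fun x => ⟨π x.1, π_lt x.2⟩
    have hg : Function.Bijective g := by
      refine ⟨fun x y e => ?_, fun a => ?_⟩
      · exact Subtype.ext (hT.eq_of_le_of_le x.2.le y.2.le
          (LevelQuotient.mk_eq_mk.1 (congrArg Subtype.val e)).1)
      · obtain ⟨x, hx, e⟩ := exists_lt a.2
        exact ⟨⟨x, hx⟩, Subtype.ext e⟩
    refine ⟨⟨Equiv.ofBijective g hg, ?_⟩⟩
    intro x y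
    refine ⟨fun hxy => ?_, π_lt⟩
    rcases hT.lt_or_eq_or_gt x.2 y.2 with h | h | h
    · exact h
    · exact absurd hxy (by simp [g, h])
    · exact absurd hxy (π_lt h).asymm
  have tree : IsTree (LevelQuotient c) := by
    intro a
    obtain ⟨z, rfl⟩ := π_surj a
    have := hT z
    exact (iso z).some.symm.toRelEmbedding.isWellOrder
  have height : ∀ z, treeHeight (π z) = treeHeight z := by
    intro z
    have := hT z
    have := tree (π z)
    rw [tree.treeHeight_eq_type, hT.treeHeight_eq_type, Ordinal.type_eq]
    exact ⟨(iso z).some.symm⟩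
  refine ⟨⟨LevelQuotient c, LevelQuotient.partialOrder hT c hc⟩, ⟨tree, ⟨fun o ho => ?_, fun a => ?_⟩,
    fun o => ?_, fun C hC => ?_⟩, π, fun _ _ => π_lt, height⟩
  · obtain ⟨x, hx⟩ := hlevels o ho
    exact ⟨π x, (height x).trans hx⟩
  · obtain ⟨x, rfl⟩ := π_surj a
    exact (height x).trans_lt (hht x)
  · refine Set.countable_iff_exists_injOn.2 ⟨LevelQuotient.colour, ?_⟩
    intro a ha b hb e
    obtain ⟨x, rfl⟩ := π_surj a
    obtain ⟨y, rfl⟩ := π_surj b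
    exact LevelQuotient.mk_eq_mk.2
      ⟨(height x).symm.trans (ha.trans (hb.symm.trans (height y))), e⟩
  · refine Set.countable_iff_exists_injOn.2 ⟨LevelQuotient.colour, ?_⟩
    intro a ha b hb e
    by_contra hab
    have key : ∀ {a b : LevelQuotient c}, a < b → a.colour ≠ b.colour := by
      intro a b hlt
      obtain ⟨z, rfl⟩ := π_surj b
      obtain ⟨x, hx, rfl⟩ := exists_lt hlt
      exact hne hx
    rcases hC ha hb hab with hlt | hlt
    · exact key hlt e
    · exact key hlt e.symm
end

section
/- Assume MA(ω₁). Then for every wide Aronszajn tree T there exists an Aronszajn tree A such that there is no weak embedding from A into T. In particular, no wide Aronszajn tree weakly embeds all Aronszajn trees. -/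
universe u

open Cardinal Ordinal Set Classical

theorem exists_ladder {W : Type*} [LinearOrder W] (hW : ∀ w : W, (Iio w).Countable) (β : W) :
    ∃ C : Set W, C ⊆ Iio β ∧ (∀ α < β, ∃ γ ∈ C, α ≤ γ) ∧ ∀ α < β, (C ∩ Iio α).Finite := by
  rcases (Iio β).eq_empty_or_nonempty with h | h
  · have h' : ∀ α, ¬ α < β := fun α hα => (h ▸ (show α ∈ Iio β from hα) : α ∈ (∅ : Set W))
    exact ⟨∅, by simp, fun α hα => (h' α hα).elim, by simp⟩
  obtain ⟨g, hg⟩ := (hW β).exists_eq_range h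
  have hlt : ∀ n, g n < β := fun n => by
    have : g n ∈ Iio β := hg ▸ mem_range_self n
    exact this
  have hsurj : ∀ α < β, ∃ n, g n = α := fun α hα => by
    have : α ∈ range g := hg ▸ hα
    exact this
  refine ⟨{γ | ∃ n, g n = γ ∧ ∀ m < n, g m < g n}, ?_, ?_, ?_⟩
  · rintro _ ⟨n, rfl, -⟩
    exact hlt n
  · intro α hα
    obtain ⟨n, rfl⟩ := hsurj α hα
    have hex : ∃ k, g n ≤ g k := ⟨n, le_rfl⟩
    refine ⟨g (Nat.find hex), ⟨_, rfl, fun m hm => ?_⟩, Nat.find_spec hex⟩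
    exact (not_le.1 (Nat.find_min hex hm)).trans_le (Nat.find_spec hex)
  · intro α hα
    obtain ⟨n, rfl⟩ := hsurj α hα
    refine ((finite_Iio n).image g).subset ?_
    rintro _ ⟨⟨k, rfl, hk⟩, hkn⟩
    refine ⟨k, ?_, rfl⟩
    by_contra hnk
    rw [mem_Iio] at hnk
    rcases (le_of_not_gt hnk : n ≤ k).eq_or_lt with rfl | h
    · exact lt_irrefl _ hkn
    · exact lt_asymm (hk n h) hkn

theorem injOn_ncard_inter_Iio {W : Type*} [LinearOrder W] {s : Set W}
    (hs : ∀ α ∈ s, (s ∩ Iio α).Finite) : InjOn (fun α => (s ∩ Iio α).ncard) s := by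
  have key : ∀ γ ∈ s, ∀ δ ∈ s, γ < δ → (s ∩ Iio γ).ncard < (s ∩ Iio δ).ncard := by
    intro γ hγ δ hδ h
    refine ncard_lt_ncard ⟨fun x hx => ⟨hx.1, hx.2.trans h⟩, fun h' => ?_⟩ (hs δ hδ)
    exact lt_irrefl _ (h' ⟨hγ, h⟩).2
  intro γ hγ δ hδ h
  rcases lt_trichotomy γ δ with h' | h' | h'
  · exact absurd h (key γ hγ δ hδ h').ne
  · exact h'
  · exact ((key δ hδ γ hγ h').ne h.symm).elim

/-- The maximal weight of the walk from `β` down to `ξ` along the ladder system `C`, whose steps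
are given by `m`. -/
noncomputable def walkWeight {W : Type*} [LinearOrder W] [WellFoundedLT W] (C : W → Set W)
    (m : W → W → W) (ξ β : W) : ℕ :=
  if _h : ξ < β ∧ m ξ β < β then max (C β ∩ Iio ξ).ncard (walkWeight C m ξ (m ξ β)) else 0
termination_by (wellFounded_lt (α := W)).wrap β
decreasing_by exact _h.2

/-- There is a coherent family of finite-to-one functions `e · β : Iio β → ℕ`. -/
theorem exists_coherent_finiteToOne {W : Type*} [LinearOrder W] [WellFoundedLT W]
    (hW : ∀ w : W, (Iio w).Countable) :
    ∃ e : W → W → ℕ, (∀ β n, {ξ | ξ < β ∧ e ξ β ≤ n}.Finite) ∧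
      ∀ α β, {ξ | ξ < α ∧ ξ < β ∧ e ξ α ≠ e ξ β}.Finite := by
  choose C hCβ hCcof hCfin using exists_ladder hW
  have hm : ∀ ξ β, ∃ γ, ξ < β → γ ∈ C β ∧ ξ ≤ γ ∧ ∀ δ ∈ C β, ξ ≤ δ → γ ≤ δ := by
    intro ξ β
    by_cases h : ξ < β
    · obtain ⟨γ, hγ⟩ := hCcof β ξ h
      obtain ⟨δ, hδ, hmin⟩ :=
        WellFounded.has_min (wellFounded_lt (α := W)) {γ | γ ∈ C β ∧ ξ ≤ γ} ⟨γ, hγ⟩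
      exact ⟨δ, fun _ => ⟨hδ.1, hδ.2, fun ε h1 h2 => not_lt.1 (hmin ε ⟨h1, h2⟩)⟩⟩
    · exact ⟨ξ, fun h' => (h h').elim⟩
  choose m hm using hm
  have hmlt : ∀ ξ β, ξ < β → m ξ β < β := fun ξ β h => hCβ β (hm ξ β h).1
  have hC : ∀ ξ β, ξ < β → C β ∩ Iio ξ = C β ∩ Iio (m ξ β) := by
    intro ξ β h
    ext c
    simp only [mem_inter_iff, mem_Iio, and_congr_right_iff]
    intro hc
    refine ⟨fun h' => h'.trans_le (hm ξ β h).2.1, fun h' => ?_⟩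
    by_contra hcξ
    exact absurd ((hm ξ β h).2.2 c hc (not_lt.1 hcξ)) (not_le.2 h')
  have heq : ∀ ξ β, ξ < β → walkWeight C m ξ β =
      max (C β ∩ Iio (m ξ β)).ncard (walkWeight C m ξ (m ξ β)) := by
    intro ξ β h
    rw [walkWeight, dif_pos ⟨h, hmlt ξ β h⟩, hC ξ β h]
  have hK : ∀ β n, {γ | γ ∈ C β ∧ (C β ∩ Iio γ).ncard ≤ n}.Finite := by
    intro β n
    refine Set.Finite.of_injOn (f := fun γ => (C β ∩ Iio γ).ncard) (t := Iic n)
      (fun γ hγ => hγ.2) ?_ (finite_Iic n)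
    exact (injOn_ncard_inter_Iio fun γ hγ => hCfin β γ (hCβ β hγ)).mono fun γ hγ => hγ.1
  have hfto : ∀ β n, {ξ | ξ < β ∧ walkWeight C m ξ β ≤ n}.Finite := by
    intro β
    induction β using WellFoundedLT.induction with
    | _ β ih =>
      intro n
      refine ((hK β n).biUnion (t := fun γ => {ξ | ξ < γ ∧ walkWeight C m ξ γ ≤ n} ∪ {γ})
        fun γ hγ => (ih γ (hCβ β hγ.1) n).union (finite_singleton γ)).subset ?_
      rintro ξ ⟨hξ, hn⟩
      rw [heq ξ β hξ, max_le_iff] at hn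
      refine mem_biUnion (x := m ξ β) ⟨(hm ξ β hξ).1, hn.1⟩ ?_
      rcases (hm ξ β hξ).2.1.eq_or_lt with h | h
      · exact Or.inr h
      · exact Or.inl ⟨h, hn.2⟩
  have hcoh : ∀ β, ∀ α < β, {ξ | ξ < α ∧ walkWeight C m ξ α ≠ walkWeight C m ξ β}.Finite := by
    intro β
    induction β using WellFoundedLT.induction with
    | _ β ih =>
      intro α hα
      have hfin : (C β ∩ Iio α ∪ {m α β}).Finite := (hCfin β α hα).union (finite_singleton _)
      refine (hfin.biUnion (t := fun γ =>
        ({ξ | ξ < α ∧ ξ < γ ∧ walkWeight C m ξ α ≠ walkWeight C m ξ γ} ∪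
          {ξ | ξ < γ ∧ walkWeight C m ξ γ ≤ (C β ∩ Iio γ).ncard}) ∪ {γ}) ?_).subset ?_
      · intro γ hγ
        have hγβ : γ < β := by
          rcases hγ with h | h
          · exact h.2.trans hα
          · rw [mem_singleton_iff] at h
            exact h ▸ hmlt α β hα
        refine (Set.Finite.union ?_ (hfto _ _)).union (finite_singleton γ)
        rcases lt_trichotomy α γ with h | rfl | h
        · exact (ih γ hγβ α h).subset fun ξ hξ => ⟨hξ.1, hξ.2.2⟩
        · simp
        · exact (ih α hα γ h).subset fun ξ hξ => ⟨hξ.2.1, hξ.2.2.symm⟩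
      · rintro ξ ⟨hξα, hne⟩
        have hξ := hξα.trans hα
        refine mem_biUnion (x := m ξ β) ?_ ?_
        · rcases lt_or_ge (m ξ β) α with h | h
          · exact Or.inl ⟨(hm ξ β hξ).1, h⟩
          · exact Or.inr (le_antisymm
              ((hm ξ β hξ).2.2 _ (hm α β hα).1 (hξα.le.trans (hm α β hα).2.1))
              ((hm α β hα).2.2 _ (hm ξ β hξ).1 h))
        · rcases (hm ξ β hξ).2.1.eq_or_lt with h | h
          · exact Or.inr h
          · left
            by_cases hle : walkWeight C m ξ (m ξ β) ≤ (C β ∩ Iio (m ξ β)).ncard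
            · exact Or.inr ⟨h, hle⟩
            · refine Or.inl ⟨hξα, h, ?_⟩
              rwa [heq ξ β hξ, max_eq_right (not_le.1 hle).le] at hne
  refine ⟨walkWeight C m, hfto, fun α β => ?_⟩
  rcases lt_trichotomy α β with h | rfl | h
  · exact (hcoh β α h).subset fun ξ hξ => ⟨hξ.1, hξ.2.2⟩
  · simp
  · exact (hcoh α β h).subset fun ξ hξ => ⟨hξ.2.1, hξ.2.2.symm⟩

/-- In a partial order without uncountable chains whose elements have countable and linearly
ordered sets of predecessors, any uncountable countable-to-one family of `k`-tuples contains two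
tuples with pairwise incomparable entries. -/
theorem exists_pairwise_incomparable_tuples {T I : Type*} [PartialOrder T]
    (hcount : ∀ x : T, (Iic x).Countable)
    (hlin : ∀ x u v : T, u ≤ x → v ≤ x → u ≤ v ∨ v ≤ u)
    (hchain : NoUncountableChain T) [Uncountable I] {k : ℕ} (x : I → Fin k → T)
    (hx : ∀ u l, {i | x i l = u}.Countable) :
    ∃ i j, i ≠ j ∧ ∀ l l', ¬ x i l ≤ x j l' ∧ ¬ x j l' ≤ x i l := by
  by_contra! hcon
  have hne : (Filter.cocountable : Filter I).NeBot := by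
    rw [Filter.neBot_iff, Ne, ← Filter.empty_mem_iff_bot, Filter.mem_cocountable, compl_empty]
    exact not_countable_univ
  let U : Ultrafilter I := Ultrafilter.of Filter.cocountable
  have hU : ∀ s : Set I, s.Countable → sᶜ ∈ U := fun s hs =>
    Ultrafilter.of_le _ (by rwa [Filter.mem_cocountable, compl_compl])
  have hpair : ∀ i, ∃ p : Fin k × Fin k, {j | x i p.1 ≤ x j p.2} ∈ U := by
    intro i
    have h1 : ({i} ∪ ⋃ p : Fin k × Fin k, {j | x j p.2 ≤ x i p.1} : Set I).Countable := by
      refine (countable_singleton i).union (countable_iUnion fun p => ?_)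
      refine ((hcount (x i p.1)).biUnion fun u _ => hx u p.2).mono fun j hj => ?_
      exact mem_biUnion (x := x j p.2) hj rfl
    have h2 : (⋃ p ∈ (univ : Set (Fin k × Fin k)), {j | x i p.1 ≤ x j p.2}) ∈ U := by
      refine Filter.mem_of_superset (hU _ h1) fun j hj => ?_
      simp only [mem_compl_iff, mem_union, mem_singleton_iff, mem_iUnion, mem_ofPred_eq, not_or,
        not_exists] at hj
      obtain ⟨l, l', h⟩ := hcon i j (Ne.symm hj.1)
      refine mem_biUnion (x := (l, l')) (mem_univ _) ?_
      by_contra hle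
      exact hj.2 (l, l') (h hle)
    obtain ⟨p, -, hp⟩ := (Ultrafilter.finite_biUnion_mem_iff finite_univ).1 h2
    exact ⟨p, hp⟩
  choose p hp using hpair
  obtain ⟨q, hq⟩ : ∃ q, ¬ (p ⁻¹' {q}).Countable := by
    by_contra! h
    refine not_countable_univ (α := I) ?_
    rw [← preimage_univ (f := p), ← iUnion_of_singleton, preimage_iUnion]
    exact countable_iUnion h
  refine hq ?_
  have hch : IsChain (· < ·) ((fun i => x i q.1) '' (p ⁻¹' {q})) := by
    rintro _ ⟨i, hi, rfl⟩ _ ⟨j, hj, rfl⟩ hij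
    have hi' := hp i
    have hj' := hp j
    rw [mem_preimage, mem_singleton_iff] at hi hj
    rw [hi] at hi'
    rw [hj] at hj'
    obtain ⟨z, hz1, hz2⟩ := U.neBot.nonempty_of_mem (Filter.inter_mem hi' hj')
    exact (hlin _ _ _ hz1 hz2).imp (fun h => lt_of_le_of_ne h hij)
      fun h => lt_of_le_of_ne h hij.symm
  refine ((hchain _ hch).biUnion fun u _ => hx u q.1).mono fun i hi => ?_
  exact mem_biUnion (x := x i q.1) (mem_image_of_mem _ hi) rfl

theorem exists_uncountable_fiber_s4 {I L : Type*} [Countable L] (s : Set I) (hs : ¬ s.Countable)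
    (f : I → L) : ∃ l, ¬ {i | i ∈ s ∧ f i = l}.Countable := by
  by_contra! h
  refine hs ((countable_iUnion h).mono fun i hi => ?_)
  exact mem_iUnion.2 ⟨f i, hi, rfl⟩

/-- Among uncountably many labelled finite subsets of `T`, two have labels that agree on the
intersection, and differences with pairwise incomparable elements. -/
theorem exists_finsets_agree_incomparable {T I L : Type*} [PartialOrder T] [Countable L]
    (hcount : ∀ x : T, (Iic x).Countable)
    (hlin : ∀ x u v : T, u ≤ x → v ≤ x → u ≤ v ∨ v ≤ u)
    (hchain : NoUncountableChain T) (s : Set I) (hs : ¬ s.Countable) (N : I → Finset T)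
    (lab : I → T → L) :
    ∃ i ∈ s, ∃ j ∈ s, i ≠ j ∧ (∀ u ∈ N i, u ∈ N j → lab i u = lab j u) ∧
      ∀ x ∈ N i, x ∉ N j → ∀ y ∈ N j, y ∉ N i → ¬ x ≤ y ∧ ¬ y ≤ x := by
  obtain ⟨k, hk⟩ := exists_uncountable_fiber_s4 s hs fun i => (N i).card
  suffices H : ∀ k (s : Set I) (N : I → Finset T), ¬ s.Countable → (∀ i ∈ s, (N i).card = k) →
      ∃ i ∈ s, ∃ j ∈ s, i ≠ j ∧ (∀ u ∈ N i, u ∈ N j → lab i u = lab j u) ∧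
        ∀ x ∈ N i, x ∉ N j → ∀ y ∈ N j, y ∉ N i → ¬ x ≤ y ∧ ¬ y ≤ x by
    obtain ⟨i, hi, j, hj, h⟩ := H k _ N hk fun i hi => hi.2
    exact ⟨i, hi.1, j, hj.1, h⟩
  clear hk k hs s N
  intro k
  induction k with
  | zero =>
    intro s N hs hN
    obtain ⟨i, hi, j, hj, hij⟩ : s.Nontrivial := by
      by_contra h
      exact hs (not_nontrivial_iff.1 h).finite.countable
    have hi0 := Finset.card_eq_zero.1 (hN i hi)
    exact ⟨i, hi, j, hj, hij, by simp [hi0], by simp [hi0]⟩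
  | succ k ih =>
    intro s N hs hN
    by_cases hu : ∃ u, ¬ {i | i ∈ s ∧ u ∈ N i}.Countable
    · obtain ⟨u, hu⟩ := hu
      obtain ⟨l, hl⟩ := exists_uncountable_fiber_s4 _ hu fun i => lab i u
      obtain ⟨i, ⟨⟨hi, hui⟩, hli⟩, j, ⟨⟨hj, huj⟩, hlj⟩, hij, h1, h2⟩ :=
        ih _ (fun i => (N i).erase u) hl fun i hi => by
          rw [Finset.card_erase_of_mem hi.1.2, hN i hi.1.1, Nat.add_sub_cancel]
      refine ⟨i, hi, j, hj, hij, fun v hvi hvj => ?_, fun x hxi hxj y hyj hyi => ?_⟩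
      · by_cases hv : v = u
        · rw [hv, hli, hlj]
        · exact h1 v (Finset.mem_erase.2 ⟨hv, hvi⟩) (Finset.mem_erase.2 ⟨hv, hvj⟩)
      · exact h2 x (Finset.mem_erase.2 ⟨fun h => hxj (h ▸ huj), hxi⟩)
          (fun h => hxj (Finset.mem_of_mem_erase h)) y
          (Finset.mem_erase.2 ⟨fun h => hyi (h ▸ hui), hyj⟩)
          (fun h => hyi (Finset.mem_of_mem_erase h))
    · push Not at hu
      have hunc : Uncountable s := not_countable_iff.1 fun h => hs (countable_coe_iff.1 h)
      let x : s → Fin (k + 1) → T := fun i l => ((N i).equivFinOfCardEq (hN i i.2)).symm l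
      obtain ⟨i, j, hij, h⟩ := exists_pairwise_incomparable_tuples hcount hlin hchain x
        fun u l => by
          refine ((hu u).preimage (Subtype.val_injective (p := (· ∈ s)))).mono fun i hi => ?_
          exact ⟨i.2, hi ▸ (((N i).equivFinOfCardEq (hN i i.2)).symm l).2⟩
      have hsurj : ∀ i : s, ∀ v ∈ N i, ∃ l, x i l = v := fun i v hv =>
        ⟨(N i).equivFinOfCardEq (hN i i.2) ⟨v, hv⟩, by simp [x]⟩
      have h' : ∀ v ∈ N i, ∀ w ∈ N j, ¬ v ≤ w ∧ ¬ w ≤ v := by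
        intro v hv w hw
        obtain ⟨l, rfl⟩ := hsurj i v hv
        obtain ⟨l', rfl⟩ := hsurj j w hw
        exact h l l'
      exact ⟨i, i.2, j, j.2, fun h => hij (Subtype.ext h),
        fun v hv hw => absurd le_rfl (h' v hv v hw).1,
        fun v hv _ w hw _ => h' v hv w hw⟩

/-- Finite approximations to a finite-to-one map `r : ℕ → ℕ` and a colouring `c` of `T` (the value
`0` means undefined) such that the elements of a colour class are incomparable and the functions
`r ∘ g · t`, for `t` in the class, agree on common predecessors. -/
structure ColoringCondition (T : Type u) [PartialOrder T] (g : T → T → ℕ) where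
  n : ℕ
  r : ℕ →₀ ℕ
  c : T →₀ ℕ
  r_eq_zero : ∀ k, n ≤ k → r k = 0
  colored : ∀ t s, t ≠ s → c t ≠ 0 → c t = c s → ¬ t < s ∧ ∀ u, u < t → u < s →
    g u t = g u s ∨ (g u t < n ∧ g u s < n ∧ r (g u t) = r (g u s))

namespace ColoringCondition

variable {T : Type u} [PartialOrder T] {g : T → T → ℕ}

instance : PartialOrder (ColoringCondition T g) where
  le p q := p.n ≤ q.n ∧ (∀ k < p.n, q.r k = p.r k) ∧ (∀ k, p.n ≤ k → k < q.n → p.n ≤ q.r k) ∧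
    ∀ t, p.c t ≠ 0 → q.c t = p.c t
  le_refl p := ⟨le_rfl, fun _ _ => rfl, fun _ h h' => absurd h' (not_lt.2 h), fun _ _ => rfl⟩
  le_trans p q w hpq hqw := by
    refine ⟨hpq.1.trans hqw.1, fun k hk => ?_, fun k hk hk' => ?_, fun t ht => ?_⟩
    · rw [hqw.2.1 k (hk.trans_le hpq.1), hpq.2.1 k hk]
    · rcases lt_or_ge k q.n with h | h
      · rw [hqw.2.1 k h]
        exact hpq.2.2.1 k hk h
      · exact hpq.1.trans (hqw.2.2.1 k h hk')
    · have := hpq.2.2.2 t ht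
      rw [hqw.2.2.2 t (this ▸ ht), this]
  le_antisymm p q hpq hqp := by
    have hn : p.n = q.n := le_antisymm hpq.1 hqp.1
    have hr : p.r = q.r := by
      ext k
      rcases lt_or_ge k p.n with h | h
      · exact (hpq.2.1 k h).symm
      · rw [p.r_eq_zero k h, q.r_eq_zero k (hn ▸ h)]
    have hc : p.c = q.c := by
      ext t
      by_cases h : p.c t = 0
      · by_cases h' : q.c t = 0
        · rw [h, h']
        · exact hqp.2.2.2 t h'
      · exact (hpq.2.2.2 t h).symm
    cases p
    cases q
    simp_all

theorem exists_le_length (p : ColoringCondition T g) (k : ℕ) : ∃ q, k < q.n ∧ p ≤ q := by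
  have hval : ∀ f : ℕ → ℕ, ∀ a : ℕ, ∃ r : ℕ →₀ ℕ, ∀ i, r i = if i < a then f i else 0 := by
    intro f a
    exact ⟨Finsupp.onFinset (Finset.range a) (fun i => if i < a then f i else 0)
      (by simp +contextual), fun i => rfl⟩
  obtain ⟨r, hr⟩ := hval (fun i => if i < p.n then p.r i else p.n) (max p.n (k + 1))
  have hrp : ∀ i < p.n, r i = p.r i := fun i hi => by
    rw [hr, if_pos (hi.trans_le (le_max_left _ _)), if_pos hi]
  refine ⟨⟨max p.n (k + 1), r, p.c, fun i hi => by rw [hr, if_neg (not_lt.2 hi)],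
    fun t s hts ht h => ?_⟩, Nat.lt_of_succ_le (le_max_right _ _), le_max_left _ _, hrp,
    fun i hi hi' => ?_, fun _ _ => rfl⟩
  · refine ⟨(p.colored t s hts ht h).1, fun u hut hus => ?_⟩
    rcases (p.colored t s hts ht h).2 u hut hus with h' | ⟨h1, h2, h3⟩
    · exact Or.inl h'
    · exact Or.inr ⟨h1.trans_le (le_max_left _ _), h2.trans_le (le_max_left _ _), by
        rw [hrp _ h1, hrp _ h2, h3]⟩
  · change p.n ≤ r i
    rw [hr, if_pos hi', if_neg (not_lt.2 hi)]

theorem exists_le_colored (p : ColoringCondition T g) (t : T) : ∃ q, q.c t ≠ 0 ∧ p ≤ q := by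
  by_cases hpt : p.c t = 0
  swap
  · exact ⟨p, hpt, le_rfl⟩
  obtain ⟨m, hm⟩ : ∃ m, ∀ s, p.c s < m := by
    refine ⟨p.c.support.sup p.c + 1, fun s => Nat.lt_succ_of_le ?_⟩
    by_cases hs : p.c s = 0
    · rw [hs]
      exact Nat.zero_le _
    · exact Finset.le_sup (f := p.c) (Finsupp.mem_support_iff.2 hs)
  have hm0 : m ≠ 0 := ((Nat.zero_le _).trans_lt (hm t)).ne'
  refine ⟨⟨p.n, p.r, p.c.update t m, p.r_eq_zero, fun a b hab ha h => ?_⟩, ?_, le_rfl,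
    fun _ _ => rfl, fun k h h' => absurd h' (not_lt.2 h), fun s hs => ?_⟩
  · rw [Finsupp.update_apply] at ha
    rw [Finsupp.update_apply, Finsupp.update_apply] at h
    by_cases hat : a = t
    · rw [if_pos hat, if_neg fun hbt => hab (hat.trans hbt.symm)] at h
      exact absurd h (hm b).ne'
    · by_cases hbt : b = t
      · rw [if_neg hat, if_pos hbt] at h
        exact absurd h (hm a).ne
      · rw [if_neg hat] at ha h
        rw [if_neg hbt] at h
        exact p.colored a b hab ha h
  · simpa using hm0
  · have : s ≠ t := fun h => hs (h ▸ hpt)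
    simp [Finsupp.update_apply, this]

/-- The coloured elements together with their predecessors at which `g` takes a small value. -/
noncomputable def nodes (hfin : ∀ t n, {u | u < t ∧ g u t < n}.Finite)
    (p : ColoringCondition T g) : Finset T :=
  p.c.support ∪ p.c.support.biUnion fun t => (hfin t p.n).toFinset

/-- The colour of `u`, and the values that `g u` takes on each colour above `u`. -/
noncomputable def label (p : ColoringCondition T g) (u : T) : ℕ × Finset (ℕ × ℕ) :=
  (p.c u, {t ∈ p.c.support | u < t}.image fun t => (p.c t, g u t))

theorem cross (hfin : ∀ t n, {u | u < t ∧ g u t < n}.Finite) {p q : ColoringCondition T g}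
    (hn : p.n = q.n) (hr : p.r = q.r)
    (hlab : ∀ u ∈ p.nodes hfin, u ∈ q.nodes hfin → p.label u = q.label u)
    (hinc : ∀ x ∈ p.nodes hfin, x ∉ q.nodes hfin → ∀ y ∈ q.nodes hfin, y ∉ p.nodes hfin →
      ¬ x ≤ y ∧ ¬ y ≤ x) {t s : T} (hts : t ≠ s) (ht : p.c t ≠ 0) (h : p.c t = q.c s) :
    ¬ t < s ∧ ∀ u, u < t → u < s → g u t ≠ g u s → g u t < p.n →
      g u s < p.n ∧ p.r (g u t) = p.r (g u s) := by
  have hs : q.c s ≠ 0 := h ▸ ht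
  have htp : t ∈ p.nodes hfin := Finset.mem_union_left _ (Finsupp.mem_support_iff.2 ht)
  have hsq : s ∈ q.nodes hfin := Finset.mem_union_left _ (Finsupp.mem_support_iff.2 hs)
  by_cases htq : t ∈ q.nodes hfin
  · have hc : p.c t = q.c t := congrArg Prod.fst (hlab t htp htq)
    obtain ⟨h1, h2⟩ := q.colored t s hts (hc ▸ ht) (hc ▸ h)
    refine ⟨h1, fun u hut hus hne _ => ?_⟩
    rw [hn, hr]
    exact ((h2 u hut hus).resolve_left hne).2
  by_cases hsp : s ∈ p.nodes hfin
  · have hc : p.c s = q.c s := congrArg Prod.fst (hlab s hsp hsq)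
    obtain ⟨h1, h2⟩ := p.colored t s hts ht (h.trans hc.symm)
    exact ⟨h1, fun u hut hus hne _ => ((h2 u hut hus).resolve_left hne).2⟩
  refine ⟨fun hlt => (hinc t htp htq s hsq hsp).1 hlt.le, fun u hut hus hne hgn => ?_⟩
  have hup : u ∈ p.nodes hfin := Finset.mem_union_right _ (Finset.mem_biUnion.2
    ⟨t, Finsupp.mem_support_iff.2 ht, (Set.Finite.mem_toFinset _).2 ⟨hut, hgn⟩⟩)
  have huq : u ∈ q.nodes hfin := by
    by_contra huq
    exact (hinc u hup huq s hsq hsp).1 hus.le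
  have hmem : (p.c t, g u t) ∈ (q.label u).2 := by
    rw [← hlab u hup huq]
    exact Finset.mem_image_of_mem (fun t => (p.c t, g u t))
      (Finset.mem_filter.2 ⟨Finsupp.mem_support_iff.2 ht, hut⟩)
  obtain ⟨s', hs', heq⟩ := Finset.mem_image.1 hmem
  obtain ⟨hs'c, hus'⟩ := Finset.mem_filter.1 hs'
  obtain ⟨hc, hg⟩ := Prod.mk.inj heq
  have hne' : s' ≠ s := fun h' => hne (by rw [← hg, h'])
  rw [← hg, hn, hr]
  exact (((q.colored s' s hne' (Finsupp.mem_support_iff.1 hs'c) (hc.trans h)).2 u hus'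
    hus).resolve_left (hg ▸ hne)).2

theorem exists_common_extension (hfin : ∀ t n, {u | u < t ∧ g u t < n}.Finite)
    (hcoh : ∀ t s, {u | u < t ∧ u < s ∧ g u t ≠ g u s}.Finite) {p q : ColoringCondition T g}
    (hn : p.n = q.n) (hr : p.r = q.r)
    (hlab : ∀ u ∈ p.nodes hfin, u ∈ q.nodes hfin → p.label u = q.label u)
    (hinc : ∀ x ∈ p.nodes hfin, x ∉ q.nodes hfin → ∀ y ∈ q.nodes hfin, y ∉ p.nodes hfin →
      ¬ x ≤ y ∧ ¬ y ≤ x) : ∃ w, p ≤ w ∧ q ≤ w := by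
  obtain ⟨n', hn'n, hn'⟩ : ∃ n', p.n ≤ n' ∧ ∀ t ∈ p.c.support, ∀ s ∈ q.c.support, ∀ u, u < t →
      u < s → g u t ≠ g u s → g u t < n' ∧ g u s < n' := by
    let F := p.c.support.biUnion fun t => q.c.support.biUnion fun s =>
      (hcoh t s).toFinset.image fun u => max (g u t) (g u s)
    refine ⟨max p.n (F.sup id + 1), le_max_left _ _, fun t ht s hs u hut hus hne => ?_⟩
    have hF : max (g u t) (g u s) ∈ F := Finset.mem_biUnion.2 ⟨t, ht, Finset.mem_biUnion.2
      ⟨s, hs, Finset.mem_image_of_mem _ ((Set.Finite.mem_toFinset _).2 ⟨hut, hus, hne⟩)⟩⟩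
    have hle : max (g u t) (g u s) ≤ F.sup id := Finset.le_sup (f := id) hF
    omega
  let r : ℕ →₀ ℕ := Finsupp.onFinset (Finset.range n')
    (fun i => if i < n' then (if i < p.n then p.r i else p.n) else 0) (by simp +contextual)
  have hrv : ∀ i, r i = if i < n' then (if i < p.n then p.r i else p.n) else 0 := fun i => rfl
  have hrp : ∀ i < p.n, r i = p.r i := fun i hi => by
    rw [hrv, if_pos (hi.trans_le hn'n), if_pos hi]
  have hrn : ∀ i, p.n ≤ i → i < n' → r i = p.n := fun i hi hi' => by
    rw [hrv, if_pos hi', if_neg (not_lt.2 hi)]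
  let c : T →₀ ℕ := Finsupp.onFinset (p.c.support ∪ q.c.support)
    (fun t => if p.c t = 0 then q.c t else p.c t) (by
      intro t ht
      rw [Finset.mem_union, Finsupp.mem_support_iff, Finsupp.mem_support_iff]
      by_cases h : p.c t = 0
      · rw [if_pos h] at ht
        exact Or.inr ht
      · exact Or.inl h)
  have hcp : ∀ t, p.c t ≠ 0 → c t = p.c t := fun t ht => if_neg ht
  have hcq : ∀ t, p.c t = 0 → c t = q.c t := fun t ht => if_pos ht
  have hcross : ∀ t s, t ≠ s → p.c t ≠ 0 → p.c t = q.c s → ¬ t < s ∧ ¬ s < t ∧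
      ∀ u, u < t → u < s → g u t = g u s ∨ (g u t < n' ∧ g u s < n' ∧ r (g u t) = r (g u s)) := by
    intro t s hts ht h
    have hs : q.c s ≠ 0 := h ▸ ht
    obtain ⟨h1, h2⟩ := cross hfin hn hr hlab hinc hts ht h
    obtain ⟨h3, h4⟩ := cross hfin hn.symm hr.symm (fun u hu hu' => (hlab u hu' hu).symm)
      (fun x hx hx' y hy hy' => (hinc y hy hy' x hx hx').symm) hts.symm hs h.symm
    refine ⟨h1, h3, fun u hut hus => or_iff_not_imp_left.2 fun hne => ?_⟩
    obtain ⟨h5, h6⟩ := hn' t (Finsupp.mem_support_iff.2 ht) s (Finsupp.mem_support_iff.2 hs) u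
      hut hus hne
    refine ⟨h5, h6, ?_⟩
    by_cases h7 : g u t < p.n
    · obtain ⟨h8, h9⟩ := h2 u hut hus hne h7
      rw [hrp _ h7, hrp _ h8, h9]
    · have h8 : ¬ g u s < p.n := fun h8 => by
        rw [hn] at h7 h8
        exact h7 (h4 u hus hut (Ne.symm hne) h8).1
      rw [hrn _ (not_lt.1 h7) h5, hrn _ (not_lt.1 h8) h6]
  have hsame : ∀ w : ColoringCondition T g, p.n = w.n → p.r = w.r → ∀ t s, t ≠ s → w.c t ≠ 0 →
      w.c t = w.c s → ¬ t < s ∧ ∀ u, u < t → u < s →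
        g u t = g u s ∨ (g u t < n' ∧ g u s < n' ∧ r (g u t) = r (g u s)) := by
    intro w hwn hwr t s hts ht h
    refine ⟨(w.colored t s hts ht h).1, fun u hut hus => ?_⟩
    refine ((w.colored t s hts ht h).2 u hut hus).imp_right fun ⟨h1, h2, h3⟩ => ?_
    rw [← hwn] at h1 h2
    exact ⟨h1.trans_le hn'n, h2.trans_le hn'n, by rw [hrp _ h1, hrp _ h2, hwr, h3]⟩
  refine ⟨⟨n', r, c, fun k hk => by rw [hrv, if_neg (not_lt.2 hk)], fun t s hts ht h => ?_⟩,
    ⟨hn'n, hrp, fun k hk hk' => (hrn k hk hk').ge, hcp⟩, ⟨hn ▸ hn'n, fun k hk => ?_,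
    fun k hk hk' => ?_, fun t ht => ?_⟩⟩
  · by_cases hpt : p.c t = 0
    · rw [hcq t hpt] at ht h
      by_cases hps : p.c s = 0
      · rw [hcq s hps] at h
        exact hsame q hn hr t s hts ht h
      · rw [hcp s hps] at h
        obtain ⟨h1, h2, h3⟩ := hcross s t hts.symm hps h.symm
        refine ⟨h2, fun u hut hus => (h3 u hus hut).imp Eq.symm
          fun ⟨h4, h5, h6⟩ => ⟨h5, h4, h6.symm⟩⟩
    · rw [hcp t hpt] at h
      by_cases hps : p.c s = 0
      · rw [hcq s hps] at h
        obtain ⟨h1, h2, h3⟩ := hcross t s hts hpt h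
        exact ⟨h1, h3⟩
      · rw [hcp s hps] at h
        exact hsame p rfl rfl t s hts hpt h
  · change r k = q.r k
    rw [← hn] at hk
    rw [hrp k hk, hr]
  · rw [← hn] at hk ⊢
    exact (hrn k hk hk').ge
  · change c t = q.c t
    by_cases hpt : p.c t = 0
    · exact hcq t hpt
    · have hp : t ∈ p.nodes hfin := Finset.mem_union_left _ (Finsupp.mem_support_iff.2 hpt)
      have hq : t ∈ q.nodes hfin := Finset.mem_union_left _ (Finsupp.mem_support_iff.2 ht)
      rw [hcp t hpt]
      exact congrArg Prod.fst (hlab t hp hq)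

theorem countable_of_pairwise_incompatible (hfin : ∀ t n, {u | u < t ∧ g u t < n}.Finite)
    (hcoh : ∀ t s, {u | u < t ∧ u < s ∧ g u t ≠ g u s}.Finite)
    (hcount : ∀ x : T, (Iic x).Countable)
    (hlin : ∀ x u v : T, u ≤ x → v ≤ x → u ≤ v ∨ v ≤ u)
    (hchain : NoUncountableChain T) (A : Set (ColoringCondition T g))
    (hA : A.Pairwise fun p q => ¬ ∃ r, p ≤ r ∧ q ≤ r) : A.Countable := by
  by_contra hunc
  obtain ⟨⟨n, r⟩, hfib⟩ := exists_uncountable_fiber_s4 A hunc fun p => (p.n, p.r)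
  obtain ⟨p, ⟨hp, hp'⟩, q, ⟨hq, hq'⟩, hpq, hlab, hinc⟩ :=
    exists_finsets_agree_incomparable hcount hlin hchain _ hfib (fun p => p.nodes hfin) label
  obtain ⟨hn, hr⟩ := Prod.mk.inj (hp'.trans hq'.symm)
  exact hA hp hq hpq (exists_common_extension hfin hcoh hn hr hlab hinc)

end ColoringCondition

open ColoringCondition in
theorem exists_finiteToOne_coloring (hMA : MAomega1.{u}) {T : Type u} [PartialOrder T]
    {g : T → T → ℕ} (hcard : Cardinal.mk T ≤ Cardinal.aleph.{u} 1)
    (hfin : ∀ t n, {u | u < t ∧ g u t < n}.Finite)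
    (hcoh : ∀ t s, {u | u < t ∧ u < s ∧ g u t ≠ g u s}.Finite)
    (hcount : ∀ x : T, (Iic x).Countable)
    (hlin : ∀ x u v : T, u ≤ x → v ≤ x → u ≤ v ∨ v ≤ u)
    (hchain : NoUncountableChain T) :
    ∃ (r : ℕ → ℕ) (c : T → ℕ), (∀ m, {k | r k ≤ m}.Finite) ∧
      ∀ t s, t ≠ s → c t = c s →
        ¬ t < s ∧ ∀ u, u < t → u < s → r (g u t) = r (g u s) := by
  let D : T ⊕ ULift.{u} ℕ → Set (ColoringCondition T g) :=
    Sum.elim (fun t => {p | p.c t ≠ 0}) fun k => {p | k.down < p.n}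
  have hD : Cardinal.mk (range D) ≤ Cardinal.aleph.{u} 1 := by
    refine Cardinal.mk_range_le.trans ?_
    rw [Cardinal.mk_sum, Cardinal.lift_id, Cardinal.lift_id]
    exact Cardinal.add_le_of_le (Cardinal.aleph0_le_aleph 1) hcard
      (Cardinal.mk_le_aleph0.trans (Cardinal.aleph0_le_aleph 1))
  obtain ⟨G, hdir, -, hG⟩ := hMA (ColoringCondition T g)
    ⟨⟨0, 0, 0, fun _ _ => rfl, fun _ _ _ h _ => absurd rfl h⟩⟩
    (countable_of_pairwise_incompatible hfin hcoh hcount hlin hchain) (range D) hD (by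
      rintro _ ⟨t | k, rfl⟩ p
      · exact exists_le_colored p t
      · exact exists_le_length p k.down)
  have hGc : ∀ t, ∃ p ∈ G, p.c t ≠ 0 := fun t => by
    obtain ⟨p, hp, hp'⟩ := hG _ ⟨Sum.inl t, rfl⟩
    exact ⟨p, hp, hp'⟩
  have hGn : ∀ k, ∃ p ∈ G, k < p.n := fun k => by
    obtain ⟨p, hp, hp'⟩ := hG _ ⟨Sum.inr ⟨k⟩, rfl⟩
    exact ⟨p, hp, hp'⟩
  choose pc hpcG hpc using hGc
  choose pn hpnG hpn using hGn
  have hrv : ∀ p ∈ G, ∀ k < p.n, (pn k).r k = p.r k := fun p hp k hk => by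
    obtain ⟨w, -, h1, h2⟩ := hdir p hp (pn k) (hpnG k)
    rw [← h1.2.1 k hk, ← h2.2.1 k (hpn k)]
  refine ⟨fun k => (pn k).r k, fun t => (pc t).c t, fun m => ?_, fun t s hts h => ?_⟩
  · refine (finite_Iio (pn m).n).subset fun k hk => ?_
    by_contra hk'
    rw [mem_Iio, not_lt] at hk'
    obtain ⟨w, hw, h1, h2⟩ := hdir (pn m) (hpnG m) (pn k) (hpnG k)
    have hkw : k < w.n := (hpn k).trans_le h2.1
    have h3 := h1.2.2.1 k hk' hkw
    rw [← hrv w hw k hkw] at h3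
    exact absurd ((hpn m).trans_le h3) (not_lt.2 hk)
  · obtain ⟨w, hw, h1, h2⟩ := hdir (pc t) (hpcG t) (pc s) (hpcG s)
    have ht := h1.2.2.2 t (hpc t)
    have hs := h2.2.2.2 s (hpc s)
    obtain ⟨h3, h4⟩ := w.colored t s hts (ht ▸ hpc t) (by rw [ht, hs]; exact h)
    refine ⟨h3, fun u hut hus => ?_⟩
    rcases h4 u hut hus with h5 | ⟨h5, h6, h7⟩
    · rw [h5]
    · exact (hrv w hw _ h5).trans (h7.trans (hrv w hw _ h6).symm)

section TreeHeight

variable {T : Type u} [PartialOrder T]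

theorem IsTree.treeHeight_eq (hT : IsTree T) (x : T) :
    treeHeight x = @Ordinal.type _ (fun a b : {y : T // y < x} => (a : T) < (b : T)) (hT x) :=
  dif_pos (hT x)

theorem IsTree.treeHeight_eq_typein_s4 (hT : IsTree T) {x y : T} (h : x < y) :
    treeHeight x =
      @Ordinal.typein _ (fun a b : {z : T // z < y} => (a : T) < (b : T)) (hT y) ⟨x, h⟩ := by
  have := hT x
  have := hT y
  rw [hT.treeHeight_eq, ← Ordinal.type_subrel, Ordinal.type_eq]
  exact ⟨⟨⟨fun a => ⟨⟨a, a.2.trans h⟩, a.2⟩, fun a => ⟨a.1, a.2⟩, fun _ => rfl, fun _ => rfl⟩,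
    Iff.rfl⟩⟩

theorem IsTree.strictMono_treeHeight (hT : IsTree T) :
    StrictMono (treeHeight : T → Ordinal.{u}) := by
  intro x y h
  rw [hT.treeHeight_eq_typein_s4 h, hT.treeHeight_eq y]
  exact @Ordinal.typein_lt_type _ _ (hT y) _

theorem IsTree.exists_le_treeHeight_eq_s4 (hT : IsTree T) {y : T} {α : Ordinal.{u}}
    (h : α ≤ treeHeight y) : ∃ x ≤ y, treeHeight x = α := by
  rcases h.eq_or_lt with rfl | h
  · exact ⟨y, le_rfl, rfl⟩
  · rw [hT.treeHeight_eq] at h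
    obtain ⟨x, hx⟩ := @Ordinal.typein_surj _ _ (hT y) _ h
    exact ⟨x, x.2.le, by rw [hT.treeHeight_eq_typein_s4 x.2, ← hx]⟩

theorem IsTree.le_or_le (hT : IsTree T) (x u v : T) (hu : u ≤ x) (hv : v ≤ x) :
    u ≤ v ∨ v ≤ u := by
  rcases hu.eq_or_lt with rfl | hu
  · exact Or.inr hv
  rcases hv.eq_or_lt with rfl | hv
  · exact Or.inl hu.le
  have := hT x
  rcases trichotomous_of (fun a b : {y : T // y < x} => (a : T) < (b : T)) ⟨u, hu⟩ ⟨v, hv⟩ with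
    h | h | h
  · exact Or.inl h.le
  · exact Or.inl (congrArg Subtype.val h).le
  · exact Or.inr h.le

theorem IsTree.countable_Iic (hT : IsTree T) (hlt : ∀ x : T, treeHeight x < omega1.{u}) (x : T) :
    (Iic x).Countable := by
  have := hT x
  have h := hlt x
  rw [hT.treeHeight_eq, omega1, Cardinal.lt_ord, Ordinal.card_type] at h
  rw [← Iio_insert]
  exact (Cardinal.le_aleph0_iff_set_countable.1 (Cardinal.lt_aleph_one_iff.1 h)).insert x

theorem countable_Iio_omega1_toType (w : omega1.{u}.ToType) : (Iio w).Countable := by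
  rw [← Cardinal.le_aleph0_iff_set_countable, ← Cardinal.lt_aleph_one_iff]
  have hmk : Cardinal.mk omega1.{u}.ToType = Cardinal.aleph 1 := Cardinal.mk_ord_toType _
  exact (Cardinal.mk_Iio_lt w (by rw [hmk, Ordinal.type_toType, omega1])).trans_eq hmk

instance : Uncountable omega1.{u}.ToType := by
  rw [← Cardinal.aleph0_lt_mk_iff, omega1, Cardinal.mk_ord_toType]
  exact Cardinal.aleph0_lt_aleph_one

end TreeHeight

/-- The nodes of the tree of restrictions of the functions `a · α : Iio α → ℕ` to initial
segments, extended by zero. -/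
@[ext]
structure RestrictionNode {W : Type u} [LinearOrder W] (a : W → W → ℕ) where
  level : W
  val : W → ℕ
  spec : ∃ α, level ≤ α ∧ ∀ ξ, val ξ = if ξ < level then a ξ α else 0

namespace RestrictionNode

variable {W : Type u} [LinearOrder W] {a : W → W → ℕ}

theorem eq_of_agree {x y : RestrictionNode a} (hl : x.level = y.level)
    (hv : ∀ ξ < x.level, x.val ξ = y.val ξ) : x = y := by
  refine RestrictionNode.ext hl (funext fun ξ => ?_)
  by_cases h : ξ < x.level
  · exact hv ξ h
  · obtain ⟨α, -, hx⟩ := x.spec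
    obtain ⟨β, -, hy⟩ := y.spec
    rw [hx, hy, if_neg h, if_neg (hl ▸ h)]

instance : PartialOrder (RestrictionNode a) where
  le x y := x.level ≤ y.level ∧ ∀ ξ < x.level, x.val ξ = y.val ξ
  le_refl x := ⟨le_rfl, fun _ _ => rfl⟩
  le_trans x y z hxy hyz := ⟨hxy.1.trans hyz.1, fun ξ hξ =>
    (hxy.2 ξ hξ).trans (hyz.2 ξ (hξ.trans_le hxy.1))⟩
  le_antisymm x y hxy hyx := eq_of_agree (le_antisymm hxy.1 hyx.1) hxy.2

theorem level_strictMono : StrictMono (level : RestrictionNode a → W) := by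
  intro x y h
  refine lt_of_le_of_ne h.le.1 fun hl => h.ne (eq_of_agree hl h.le.2)

theorem lt_of_le_of_level_lt {x y : RestrictionNode a} (h : x ≤ y) (hl : x.level < y.level) :
    x < y :=
  lt_of_le_of_ne h fun h' => hl.ne (h' ▸ rfl)

/-- The restriction of a node to a smaller level. -/
noncomputable def restrict (x : RestrictionNode a) (β : W) (h : β ≤ x.level) :
    RestrictionNode a where
  level := β
  val ξ := if ξ < β then x.val ξ else 0
  spec := by
    obtain ⟨α, hα, hx⟩ := x.spec
    refine ⟨α, h.trans hα, fun ξ => ?_⟩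
    by_cases hξ : ξ < β
    · rw [if_pos hξ, if_pos hξ, hx, if_pos (hξ.trans_le h)]
    · rw [if_neg hξ, if_neg hξ]

theorem restrict_le (x : RestrictionNode a) (β : W) (h : β ≤ x.level) : x.restrict β h ≤ x :=
  ⟨h, fun _ hξ => if_pos hξ⟩

/-- The node given by the function `a · α` itself. -/
noncomputable def top (a : W → W → ℕ) (α : W) : RestrictionNode a where
  level := α
  val ξ := if ξ < α then a ξ α else 0
  spec := ⟨α, le_rfl, fun _ => rfl⟩

theorem eq_restrict_of_le {x y : RestrictionNode a} (h : x ≤ y) : x = y.restrict x.level h.1 :=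
  eq_of_agree rfl fun ξ hξ => (h.2 ξ hξ).trans (if_pos hξ).symm

/-- The predecessors of a node correspond to the smaller levels. -/
noncomputable def predecessorsIso (x : RestrictionNode a) :
    (fun y z : {y : RestrictionNode a // y < x} => (y : RestrictionNode a) < z) ≃r
      (Subrel (· < · : W → W → Prop) (· < x.level)) where
  toFun y := ⟨y.1.level, level_strictMono y.2⟩
  invFun β := ⟨x.restrict β.1 (le_of_lt β.2), lt_of_le_of_level_lt (x.restrict_le _ _) β.2⟩
  left_inv y := Subtype.ext (eq_restrict_of_le y.2.le).symm
  right_inv _ := rfl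
  map_rel_iff' {y z} := by
    refine ⟨fun h => lt_of_le_of_level_lt ⟨le_of_lt h, fun ξ hξ => ?_⟩ h,
      fun h => level_strictMono h⟩
    rw [y.2.le.2 ξ hξ]
    exact (z.2.le.2 ξ (lt_trans hξ h)).symm

theorem countable_level (hW : ∀ w : W, (Iio w).Countable)
    (hcoh : ∀ α β, {ξ | ξ < α ∧ ξ < β ∧ a ξ α ≠ a ξ β}.Finite) (β : W) :
    {x : RestrictionNode a | x.level = β}.Countable := by
  have := (hW β).to_subtype
  have hfin : ∀ x : {x : RestrictionNode a | x.level = β},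
      (Function.support fun ξ : Iio β => (x.1.val ξ : ℤ) - a ξ β).Finite := by
    rintro ⟨x, rfl⟩
    obtain ⟨α, hα, hx⟩ := x.spec
    refine ((hcoh α x.level).preimage Subtype.val_injective.injOn).subset fun ξ hξ => ?_
    refine ⟨ξ.2.trans_le hα, ξ.2, fun h => hξ ?_⟩
    change (x.val ξ : ℤ) - a ξ x.level = 0
    rw [hx, if_pos (mem_Iio.1 ξ.2), h]
    exact sub_self _
  refine countable_coe_iff.1 (Function.Injective.countable
    (f := fun x => Finsupp.ofSupportFinite _ (hfin x)) fun x y hxy => ?_)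
  refine Subtype.ext (eq_of_agree (x.2.trans y.2.symm) fun ξ hξ => ?_)
  have h := DFunLike.congr_fun hxy (⟨ξ, hξ.trans_eq x.2⟩ : Iio β)
  simp only [Finsupp.ofSupportFinite_coe] at h
  exact_mod_cast sub_left_inj.1 h

theorem noUncountableChain [Uncountable W] (hW : ∀ w : W, (Iio w).Countable)
    (hfin : ∀ β n, {ξ | ξ < β ∧ a ξ β ≤ n}.Finite) :
    NoUncountableChain (RestrictionNode a) := by
  intro C hC
  by_contra hunc
  have hcof : ∀ w : W, ∃ x ∈ C, w < x.level := by
    by_contra! hcon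
    obtain ⟨w, hw⟩ := hcon
    have hIic : (Iic w).Countable := by
      rw [← Iio_insert]
      exact (hW w).insert w
    refine hunc (MapsTo.countable_of_injOn (f := level) (t := Iic w) hw ?_ hIic)
    intro x hx y hy hxy
    by_contra hne
    rcases hC hx hy hne with h | h
    · exact (level_strictMono h).ne hxy
    · exact (level_strictMono h).ne' hxy
  choose x hxC hx using hcof
  have hval : ∀ y ∈ C, ∀ ξ < y.level, (x ξ).val ξ = y.val ξ := by
    intro y hy ξ hξ
    by_cases hne : x ξ = y
    · rw [hne]
    rcases hC (hxC ξ) hy hne with h | h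
    · exact h.le.2 ξ (hx ξ)
    · exact (h.le.2 ξ hξ).symm
  obtain ⟨n, hn⟩ := exists_uncountable_fiber_s4 univ (not_countable_univ (α := W))
    fun ξ => (x ξ).val ξ
  refine hn (MapsTo.countable_of_injOn (mapsTo_univ _ _) (injOn_ncard_inter_Iio fun w _ => ?_)
    countable_univ)
  obtain ⟨α, hα, hv⟩ := (x w).spec
  refine (hfin α n).subset fun ξ hξ => ?_
  have hξl : ξ < (x w).level := lt_trans hξ.2 (hx w)
  refine ⟨hξl.trans_le hα, le_of_eq ?_⟩
  rw [← hξ.1.2, hval _ (hxC w) ξ hξl, hv, if_pos hξl]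

variable [WellFoundedLT W]

theorem isTree (a : W → W → ℕ) : IsTree (RestrictionNode a) := fun x =>
  x.predecessorsIso.toRelEmbedding.isWellOrder

theorem treeHeight_eq (x : RestrictionNode a) :
    treeHeight x = Ordinal.typein (· < · : W → W → Prop) x.level := by
  have := isTree a x
  rw [(isTree a).treeHeight_eq, ← Ordinal.type_subrel, Ordinal.type_eq]
  exact ⟨x.predecessorsIso⟩

end RestrictionNode

/-- An Aronszajn tree of restrictions of `a`, together with a colouring of `T` on whose colour
classes the functions `a · α` agree along common predecessors, rules out weak embeddings. -/
theorem RestrictionNode.not_exists_isWeakEmbedding {T W : Type u} [PartialOrder T] [LinearOrder W]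
    [WellFoundedLT W] [Uncountable W] {a : W → W → ℕ} {h : T → W} (hmono : StrictMono h)
    (hex : ∀ x, ∀ w ≤ h x, ∃ u ≤ x, h u = w)
    (hlin : ∀ x u v : T, u ≤ x → v ≤ x → u ≤ v ∨ v ≤ u) (c : T → ℕ)
    (hc : ∀ t s, t ≠ s → c t = c s →
      ¬ t < s ∧ ∀ u, u < t → u < s → a (h u) (h t) = a (h u) (h s)) :
    ¬ ∃ f : RestrictionNode a → T, IsWeakEmbedding f := by
  rintro ⟨f, hf⟩
  have hfle : ∀ x y, x ≤ y → f x ≤ f y := fun x y hxy => by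
    rcases hxy.eq_or_lt with rfl | hxy
    · exact le_rfl
    · exact (hf x y hxy).le
  have hlevel : ∀ w : W, ∀ x : RestrictionNode a, x.level = w → w ≤ h (f x) := by
    intro w
    induction w using WellFoundedLT.induction with
    | _ w ih =>
      rintro x rfl
      by_contra hlt
      rw [not_le] at hlt
      have h1 := ih _ hlt (x.restrict _ hlt.le) rfl
      exact absurd (hmono (hf _ _ (lt_of_le_of_level_lt (x.restrict_le _ hlt.le) hlt)))
        (not_lt.2 h1)
  choose t ht hht using fun α => hex (f (top a α)) α (hlevel α _ rfl)
  obtain ⟨n, hn⟩ := exists_uncountable_fiber_s4 univ (not_countable_univ (α := W)) fun α => c (t α)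
  obtain ⟨α, hα, β, hβ, hαβ⟩ : {α : W | α ∈ (Set.univ : Set W) ∧ c (t α) = n}.Nontrivial := by
    by_contra h
    exact hn (not_nontrivial_iff.1 h).finite.countable
  wlog hlt : α < β generalizing α β
  · exact this β hβ α hα hαβ.symm (lt_of_le_of_ne (not_lt.1 hlt) hαβ.symm)
  have hne : t α ≠ t β := fun h' => hαβ (by rw [← hht α, h', hht β])
  obtain ⟨hinc, hag⟩ := hc _ _ hne (hα.2.trans hβ.2.symm)
  obtain ⟨δ, hδ, hmin⟩ := WellFounded.has_min (wellFounded_lt (α := W))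
    {δ | α ≤ δ ∨ a δ α ≠ a δ β} ⟨α, Or.inl le_rfl⟩
  have hδα : δ ≤ α := not_lt.1 (hmin α (Or.inl le_rfl))
  have hy : (top a α).restrict δ hδα ≤ top a β := by
    refine ⟨hδα.trans hlt.le, fun ξ hξ => ?_⟩
    have h1 : ¬ (α ≤ ξ ∨ a ξ α ≠ a ξ β) := fun h' => hmin ξ h' hξ
    rw [not_or, not_le, not_ne_iff] at h1
    have hξ' : ξ < δ := hξ
    simp [restrict, top, hξ', h1.1, h1.1.trans hlt, h1.2]
  obtain ⟨u, hu, hhu⟩ := hex (f ((top a α).restrict δ hδα)) δ (hlevel δ _ rfl)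
  have hle : ∀ γ, δ ≤ γ → (top a α).restrict δ hδα ≤ top a γ → u ≤ t γ := by
    intro γ hγ hyγ
    rcases hlin _ _ _ (hu.trans (hfle _ _ hyγ)) (ht γ) with h' | h'
    · exact h'
    · rcases h'.eq_or_lt with h' | h'
      · exact h'.ge
      · have := hmono h'
        rw [hht, hhu] at this
        exact absurd this (not_lt.2 hγ)
  have huα := hle α hδα (restrict_le _ _ _)
  have huβ := hle β (hδα.trans hlt.le) hy
  rcases huα.eq_or_lt with rfl | huα'
  · exact hinc (lt_of_le_of_ne huβ hne)
  · have hδα' : δ < α := by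
      rw [← hhu, ← hht α]
      exact hmono huα'
    have huβ' : u < t β := lt_of_le_of_ne huβ fun h' => by
      rw [h', hht] at hhu
      exact lt_irrefl _ (hhu ▸ hδα'.trans hlt)
    have h1 := hag u huα' huβ'
    rw [hhu, hht, hht] at h1
    exact (hδ.resolve_left (not_le.2 hδα')) h1

theorem exists_isAronszajn_not_weakEmbedding (hMA : MAomega1.{u}) (T : Type u) [PartialOrder T]
    (hT : IsWideAronszajn T) : ∃ A : PoType.{u}, IsAronszajn A.carrier ∧
      ¬ ∃ f : A.carrier → T, IsWeakEmbedding f := by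
  obtain ⟨htree, hcard, ⟨-, hlt⟩, hchain⟩ := hT
  let W := omega1.{u}.ToType
  have hW : ∀ w : W, (Iio w).Countable := countable_Iio_omega1_toType
  have hsurj : ∀ α < omega1.{u}, ∃ w : W, Ordinal.typein (· < · : W → W → Prop) w = α := by
    intro α hα
    exact Ordinal.typein_surj _ (hα.trans_eq (Ordinal.type_toType _).symm)
  choose h hh using fun x => hsurj _ (hlt x)
  have hmono : StrictMono h := fun x y hxy => by
    rw [← Ordinal.typein_lt_typein (· < · : W → W → Prop), hh, hh]
    exact htree.strictMono_treeHeight hxy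
  have hex : ∀ x, ∀ w ≤ h x, ∃ u ≤ x, h u = w := by
    intro x w hw
    rw [← not_lt, ← Ordinal.typein_lt_typein (· < · : W → W → Prop), not_lt, hh] at hw
    obtain ⟨u, hu, hux⟩ := htree.exists_le_treeHeight_eq_s4 hw
    exact ⟨u, hu, Ordinal.typein_injective (· < · : W → W → Prop) ((hh u).trans hux)⟩
  have hlin := htree.le_or_le
  have hinj : ∀ t, InjOn h (Iio t) := by
    intro t u hu v hv huv
    rcases hlin t u v (le_of_lt hu) (le_of_lt hv) with h' | h'
    · exact h'.eq_or_lt.resolve_right fun h' => (hmono h').ne huv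
    · exact (h'.eq_or_lt.resolve_right fun h' => (hmono h').ne' huv).symm
  obtain ⟨e, he, hecoh⟩ := exists_coherent_finiteToOne hW
  obtain ⟨r, c, hr, hc⟩ := exists_finiteToOne_coloring hMA (g := fun u t => e (h u) (h t)) hcard.le
    (fun t n => Set.Finite.of_injOn (t := {ξ | ξ < h t ∧ e ξ (h t) ≤ n})
      (fun u hu => ⟨hmono hu.1, le_of_lt hu.2⟩)
      ((hinj t).mono fun u hu => hu.1) (he (h t) n))
    (fun t s => Set.Finite.of_injOn (t := {ξ | ξ < h t ∧ ξ < h s ∧ e ξ (h t) ≠ e ξ (h s)})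
      (fun u hu => ⟨hmono hu.1, hmono hu.2.1, hu.2.2⟩)
      ((hinj t).mono fun u hu => hu.1) (hecoh (h t) (h s)))
    (htree.countable_Iic hlt) hlin hchain
  let a : W → W → ℕ := fun ξ β => r (e ξ β)
  have ha : ∀ β n, {ξ | ξ < β ∧ a ξ β ≤ n}.Finite := by
    intro β n
    refine ((hr n).biUnion fun k _ => he β k).subset fun ξ hξ => ?_
    exact mem_biUnion (x := e ξ β) hξ.2 ⟨hξ.1, le_rfl⟩
  have hacoh : ∀ α β, {ξ | ξ < α ∧ ξ < β ∧ a ξ α ≠ a ξ β}.Finite := fun α β =>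
    (hecoh α β).subset fun ξ hξ => ⟨hξ.1, hξ.2.1, fun h' => hξ.2.2 (congrArg r h')⟩
  refine ⟨⟨RestrictionNode a, inferInstance⟩, ⟨RestrictionNode.isTree a, ⟨fun α hα => ?_,
    fun x => ?_⟩, fun α => ?_, RestrictionNode.noUncountableChain hW ha⟩,
    RestrictionNode.not_exists_isWeakEmbedding hmono hex hlin c hc⟩
  · obtain ⟨w, rfl⟩ := hsurj α hα
    exact ⟨RestrictionNode.top a w, RestrictionNode.treeHeight_eq _⟩
  · rw [RestrictionNode.treeHeight_eq]
    exact (Ordinal.typein_lt_type _ _).trans_eq (Ordinal.type_toType _)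
  · by_cases hα : α < omega1.{u}
    · obtain ⟨w, rfl⟩ := hsurj α hα
      refine (RestrictionNode.countable_level hW hacoh w).mono fun x hx => ?_
      exact Ordinal.typein_injective (· < · : W → W → Prop)
        ((RestrictionNode.treeHeight_eq x).symm.trans hx)
    · refine countable_empty.mono fun x hx => hα ?_
      rw [← (hx : treeHeight x = α), RestrictionNode.treeHeight_eq]
      exact (Ordinal.typein_lt_type _ _).trans_eq (Ordinal.type_toType _)

/-- Under MA(ω₁), for every wide Aronszajn tree `T` there is an Aronszajn tree `A`
with no weak embedding from `A` into `T`; in particular no wide Aronszajn tree weakly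
embeds all Aronszajn trees. -/
theorem wide_Aronszajn_not_universal_for_Aronszajn (hMA : MAomega1.{u}) :
    (∀ (T : Type u) [PartialOrder T], IsWideAronszajn T →
      ∃ A : PoType.{u}, IsAronszajn A.carrier ∧
        ¬ ∃ f : A.carrier → T, IsWeakEmbedding f) ∧
    ∀ (T : Type u) [PartialOrder T], IsWideAronszajn T →
      ¬ ∀ (S : Type u) [PartialOrder S], IsAronszajn S →
        ∃ f : S → T, IsWeakEmbedding f := by
  refine ⟨fun T _ hT => exists_isAronszajn_not_weakEmbedding hMA T hT, fun T _ hT hall => ?_⟩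
  obtain ⟨A, hA, hno⟩ := exists_isAronszajn_not_weakEmbedding hMA T hT
  exact hno (hall A.carrier hA)
end
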